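/- arXiv:1108.2871 — 3 statements merged into one kernel-verified Lean document; each statement's English description precedes it below -/
import Mathlib

section
/- For every α, β ≥ 1 there exists a constant γ = γ(α,β) > 0, independent of n, such that the following holds for all sufficiently large n: if P ⊂ ℝⁿ is a polytope (convex hull of a finite set) that contains the set {x ∈ ℝⁿ : |⟨x, uᵢ⟩| ≤ 1 for i = 1, …, m}, where u₁, …, u_m ∈ ℝⁿ satisfy ‖uᵢ‖ ≤ 1 for all i and m ≤ αn, and P is contained in the Euclidean ball {x ∈ ℝⁿ : ‖x‖ ≤ β√n}, then P has at least exp(γn) vertices. -/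
open scoped RealInnerProductSpace

open Finset in
theorem sum_pow_natAbs_le {q : ℝ} (hq : 0 ≤ q) (hq2 : q ≤ 1 / 2) (L : ℕ) :
    ∑ k ∈ Icc (-(L : ℤ)) L, q ^ k.natAbs ≤ 1 + 4 * q := by
  suffices h : ∑ k ∈ Icc (-(L : ℤ)) L, q ^ k.natAbs ≤ 1 + 4 * q * (1 - q ^ L) by
    have : 0 ≤ q * q ^ L := by positivity
    linarith
  induction L with
  | zero => simp
  | succ L ih =>
    have : Icc (-((L + 1 : ℕ) : ℤ)) ((L + 1 : ℕ) : ℤ) =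
        insert (-((L : ℤ) + 1)) (insert ((L : ℤ) + 1) (Icc (-(L : ℤ)) L)) := by
      ext x; simp only [mem_Icc, mem_insert]; push_cast; omega
    rw [this, sum_insert (by simp; omega), sum_insert (by simp)]
    have h1 : (-((L : ℤ) + 1)).natAbs = L + 1 := by omega
    have h2 : ((L : ℤ) + 1).natAbs = L + 1 := by omega
    rw [h1, h2]
    have h3 : 0 ≤ q * q ^ L := by positivity
    have h4 : (q * q ^ L) * q ≤ (q * q ^ L) * (1 / 2) := by gcongr
    rw [pow_succ]
    nlinarith

open Finset in
/-- If the vectors `b ω ∈ ℤ^ι` are small on average, then `b` has many collisions. -/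
theorem sq_sum_exp_le_card_collisions {Ω ι : Type*} [Fintype Ω] [Fintype ι] [DecidableEq ι]
    (b : Ω → ι → ℤ) {l : ℝ} (hl : Real.exp (-(2 * l)) ≤ 1 / 2) :
    (∑ ω, Real.exp (-(l * ∑ i, |(b ω i : ℝ)|))) ^ 2 ≤
      (∑ ω, ∑ ω', if b ω = b ω' then (1 : ℝ) else 0) *
        (1 + 4 * Real.exp (-(2 * l))) ^ Fintype.card ι := by
  obtain ⟨L, hL⟩ : ∃ L : ℕ, ∀ ω i, (b ω i).natAbs ≤ L := by
    refine ⟨univ.sup fun ω => univ.sup fun i => (b ω i).natAbs, fun ω i => ?_⟩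
    exact (le_sup (f := fun i => (b ω i).natAbs) (mem_univ i)).trans
      (le_sup (f := fun ω => univ.sup fun i => (b ω i).natAbs) (mem_univ ω))
  set C : Finset (ι → ℤ) := Fintype.piFinset fun _ => Icc (-(L : ℤ)) L
  have hC : ∀ ω ∈ (univ : Finset Ω), b ω ∈ C := fun ω _ => by
    simp only [C, Fintype.mem_piFinset, mem_Icc]
    intro i; have := hL ω i; omega
  set w : (ι → ℤ) → ℝ := fun c => Real.exp (-(l * ∑ i, |(c i : ℝ)|))
  set p : (ι → ℤ) → ℝ := fun c => ∑ ω, if b ω = c then (1 : ℝ) else 0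
  have hgroup : ∀ f : (ι → ℤ) → ℝ, ∑ ω, f (b ω) = ∑ c ∈ C, p c * f c := by
    intro f
    simp only [p, sum_mul, ite_mul, one_mul, zero_mul]
    rw [sum_comm]
    refine sum_congr rfl fun ω hω => ?_
    rw [sum_ite_eq, if_pos (hC ω hω)]
  have hw : ∑ c ∈ C, w c ^ 2 ≤ (1 + 4 * Real.exp (-(2 * l))) ^ Fintype.card ι := by
    have : ∀ c, w c ^ 2 = ∏ i, Real.exp (-(2 * l)) ^ (c i).natAbs := by
      intro c
      simp only [w, ← Real.exp_nat_mul, ← Real.exp_sum]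
      congr 1
      rw [← mul_neg, mul_neg, mul_neg, ← mul_assoc, mul_sum, ← sum_neg_distrib]
      refine sum_congr rfl fun i _ => ?_
      rw [Nat.cast_natAbs]; push_cast; ring
    simp only [this, C]
    rw [← prod_univ_sum (fun _ => Icc (-(L : ℤ)) L)
      fun _ k => Real.exp (-(2 * l)) ^ k.natAbs, prod_const, card_univ]
    gcongr
    exact sum_pow_natAbs_le (Real.exp_pos _).le hl L
  calc (∑ ω, w (b ω)) ^ 2 = (∑ c ∈ C, p c * w c) ^ 2 := by rw [hgroup]
    _ ≤ (∑ c ∈ C, p c ^ 2) * ∑ c ∈ C, w c ^ 2 := sum_mul_sq_le_sq_mul_sq _ _ _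
    _ = (∑ ω, p (b ω)) * ∑ c ∈ C, w c ^ 2 := by rw [hgroup]; simp only [sq]
    _ ≤ (∑ ω, p (b ω)) * (1 + 4 * Real.exp (-(2 * l))) ^ Fintype.card ι := by
        gcongr
    _ = _ := by simp only [p, eq_comm]

open Finset in
theorem card_mul_exp_le_sum_exp {Ω : Type*} [Fintype Ω] (X : Ω → ℝ) {l μ : ℝ} (hl : 0 ≤ l)
    (hX : ∑ ω, X ω ≤ Fintype.card Ω * μ) :
    Fintype.card Ω * Real.exp (-(l * μ)) ≤ ∑ ω, Real.exp (-(l * X ω)) := by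
  have h : ∀ ω, Real.exp (-(l * μ)) * (1 - l * (X ω - μ)) ≤ Real.exp (-(l * X ω)) := fun ω => by
    have := Real.add_one_le_exp (-(l * (X ω - μ)))
    calc _ ≤ Real.exp (-(l * μ)) * Real.exp (-(l * (X ω - μ))) := by gcongr; linarith
      _ = _ := by rw [← Real.exp_add]; ring_nf
  refine le_trans ?_ (sum_le_sum fun ω _ => h ω)
  rw [← mul_sum, sum_sub_distrib, ← mul_sum, sum_sub_distrib, mul_comm]
  simp only [sum_const, card_univ, nsmul_eq_mul, mul_one]
  gcongr
  nlinarith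

/-- The sign `±1` encoded by a Boolean. -/
def boolSign (b : Bool) : ℝ := if b then 1 else -1

theorem abs_round_le (t : ℝ) : |(round t : ℝ)| ≤ 16 * t ^ 4 := by
  rcases lt_or_ge |t| (1 / 2) with h | h
  · have : round t = 0 := by
      rw [round_eq_zero_iff]; rw [abs_lt] at h; constructor <;> linarith
    rw [this, Int.cast_zero, abs_zero]
    exact mul_nonneg (by norm_num) (Even.pow_nonneg (by decide) t)
  · have h1 := abs_sub_round t
    have h2 : |(round t : ℝ)| ≤ |t| + |t - round t| := by
      have := abs_sub t (t - round t); simpa using this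
    have h3 : (1 / 2 : ℝ) ^ 3 ≤ |t| ^ 3 := by gcongr
    have h4 : t ^ 4 = |t| ^ 3 * |t| := by rw [← pow_succ]; exact (Even.pow_abs (by decide) t).symm
    rw [h4]; nlinarith

theorem pow_four_le_cosh (y : ℝ) : y ^ 4 ≤ 24 * Real.cosh y := by
  have h := Real.hasSum_cosh y
  have := sum_le_hasSum {2} (fun i _ => by rw [pow_mul]; positivity) h
  norm_num [Nat.factorial] at this
  linarith

open Finset in
theorem sum_exp_boolSign_le {n : ℕ} (w : Fin n → ℝ) :
    ∑ ε : Fin n → Bool, Real.exp (∑ j, boolSign (ε j) * w j) ≤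
      2 ^ n * Real.exp ((∑ j, w j ^ 2) / 2) := by
  simp only [Real.exp_sum]
  have := (prod_univ_sum (fun _ : Fin n => (univ : Finset Bool))
    fun j b => Real.exp (boolSign b * w j)).symm
  rw [Fintype.piFinset_univ] at this
  rw [this, sum_div, Real.exp_sum]
  calc _ ≤ ∏ j : Fin n, (2 * Real.exp (w j ^ 2 / 2)) := by
        refine prod_le_prod (fun j _ => by positivity) fun j _ => ?_
        have := Real.cosh_le_exp_half_sq (w j)
        rw [Real.cosh_eq] at this
        simp [boolSign]
        linarith
    _ = _ := by simp [prod_mul_distrib]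

open Finset in
theorem sum_abs_round_le {n : ℕ} (u : Fin n → ℝ) (hu : ∑ j, u j ^ 2 ≤ 1) (σ : ℝ) :
    ∑ ε : Fin n → Bool, |(round (σ * ∑ j, boolSign (ε j) * u j) : ℝ)| ≤
      2 ^ n * (768 * σ ^ 4) := by
  have hexp : Real.exp ((∑ j, u j ^ 2) / 2) ≤ 2 := by
    have h1 : Real.exp ((∑ j, u j ^ 2) / 2) ≤ Real.exp (1 / 2) := by gcongr
    have h2 : Real.exp (1 / 2) ^ 2 = Real.exp 1 := by rw [← Real.exp_nat_mul]; norm_num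
    nlinarith [Real.exp_one_lt_d9, Real.exp_pos (1 / 2)]
  have hp := sum_exp_boolSign_le u
  have hm := sum_exp_boolSign_le fun j => -u j
  simp only [neg_sq, mul_neg, sum_neg_distrib] at hm
  have key : ∀ ε : Fin n → Bool, |(round (σ * ∑ j, boolSign (ε j) * u j) : ℝ)| ≤
      192 * σ ^ 4 * (Real.exp (∑ j, boolSign (ε j) * u j) +
        Real.exp (-∑ j, boolSign (ε j) * u j)) := fun ε => by
    have h1 := abs_round_le (σ * ∑ j, boolSign (ε j) * u j)
    have h2 := pow_four_le_cosh (∑ j, boolSign (ε j) * u j)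
    rw [Real.cosh_eq] at h2
    rw [mul_pow] at h1
    have : 0 ≤ σ ^ 4 := by positivity
    nlinarith
  calc _ ≤ _ := sum_le_sum fun ε _ => key ε
    _ = 192 * σ ^ 4 * (∑ ε : Fin n → Bool, Real.exp (∑ j, boolSign (ε j) * u j) +
        ∑ ε : Fin n → Bool, Real.exp (-∑ j, boolSign (ε j) * u j)) := by
      rw [← mul_sum, sum_add_distrib]
    _ ≤ 192 * σ ^ 4 * (2 ^ n * 2 + 2 ^ n * 2) := by
      have : (2 : ℝ) ^ n * Real.exp ((∑ j, u j ^ 2) / 2) ≤ 2 ^ n * 2 := by gcongr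
      gcongr <;> linarith
    _ = _ := by ring

open Finset in
theorem sum_sum_exp_boolSign_sub_le {n : ℕ} (v : Fin n → ℝ) {σ τ : ℝ} (h0 : 0 ≤ τ * σ)
    (h1 : 8 * (τ * σ) ≤ 1) :
    ∑ ε : Fin n → Bool, ∑ ε' : Fin n → Bool,
      Real.exp (∑ j, (τ * (v j * (boolSign (ε j) - boolSign (ε' j))) -
        τ * σ * (boolSign (ε j) - boolSign (ε' j)) ^ 2)) ≤
      4 ^ n * Real.exp (2 * τ ^ 2 * ∑ j, v j ^ 2 - n * (τ * σ)) := by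
  simp only [Real.exp_sum]
  have hin : ∀ ε : Fin n → Bool, _ := fun ε =>
    (prod_univ_sum (fun _ : Fin n => (univ : Finset Bool)) fun j b => Real.exp (τ * (v j * (boolSign (ε j) - boolSign b)) -
        τ * σ * (boolSign (ε j) - boolSign b) ^ 2)).symm
  have hout := (prod_univ_sum (fun _ : Fin n => (univ : Finset Bool))
    fun j a => ∑ b, Real.exp (τ * (v j * (boolSign a - boolSign b)) -
        τ * σ * (boolSign a - boolSign b) ^ 2)).symm
  simp only [Fintype.piFinset_univ] at hin hout
  simp only [hin, hout]
  calc _ ≤ ∏ j : Fin n, (4 * Real.exp (2 * τ ^ 2 * v j ^ 2 - τ * σ)) := by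
        refine prod_le_prod (fun j _ => by positivity) fun j _ => ?_
        have hc := Real.cosh_le_exp_half_sq (2 * τ * v j)
        rw [Real.cosh_eq] at hc
        have e1 : (2 * τ * v j) ^ 2 / 2 = 2 * τ ^ 2 * v j ^ 2 := by ring
        rw [e1] at hc
        have e2 : Real.exp (-(4 * (τ * σ))) ≤ 1 - 2 * (τ * σ) := by
          have := Real.abs_exp_sub_one_sub_id_le (x := -(4 * (τ * σ)))
            (by rw [abs_neg, abs_of_nonneg (by linarith)]; linarith)
          nlinarith [(abs_le.mp this).2]
        have e3 := Real.add_one_le_exp (-(τ * σ))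
        have e4 : 1 ≤ Real.exp (2 * τ ^ 2 * v j ^ 2) := Real.one_le_exp (by positivity)
        simp only [Fintype.sum_bool, boolSign, if_true, Bool.false_eq_true, if_false]
        have e5 : Real.exp (τ * (v j * (1 - -1)) - τ * σ * (1 - -1) ^ 2) =
          Real.exp (2 * τ * v j) * Real.exp (-(4 * (τ * σ))) := by rw [← Real.exp_add]; ring_nf
        have e6 : Real.exp (τ * (v j * (-1 - 1)) - τ * σ * (-1 - 1) ^ 2) =
          Real.exp (-(2 * τ * v j)) * Real.exp (-(4 * (τ * σ))) := by rw [← Real.exp_add]; ring_nf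
        have e7 : Real.exp (2 * τ ^ 2 * v j ^ 2 - τ * σ) =
          Real.exp (2 * τ ^ 2 * v j ^ 2) * Real.exp (-(τ * σ)) := by rw [← Real.exp_add]; ring_nf
        rw [e5, e6, e7]
        simp only [sub_self, mul_zero, Real.exp_zero, ne_eq, OfNat.ofNat_ne_zero,
          not_false_eq_true, zero_pow]
        have e8 := Real.exp_pos (-(4 * (τ * σ)))
        have e9 : (Real.exp (2 * τ * v j) + Real.exp (-(2 * τ * v j))) * Real.exp (-(4 * (τ * σ)))
          ≤ 2 * Real.exp (2 * τ ^ 2 * v j ^ 2) * Real.exp (-(4 * (τ * σ))) := by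
          gcongr; linarith
        nlinarith
    _ = _ := by
      rw [prod_mul_distrib, prod_const, card_univ, Fintype.card_fin, ← Real.exp_sum,
        sum_sub_distrib, ← mul_sum]
      simp

theorem convexHull_extremePoints_of_finset {E : Type*} [NormedAddCommGroup E] [NormedSpace ℝ E]
    (S : Finset E) :
    (Set.extremePoints ℝ (convexHull ℝ (S : Set E))).Finite ∧
      convexHull ℝ (Set.extremePoints ℝ (convexHull ℝ (S : Set E))) = convexHull ℝ (S : Set E) := by
  have hfin := S.finite_toSet.subset (extremePoints_convexHull_subset (𝕜 := ℝ) (A := (S : Set E)))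
  refine ⟨hfin, ?_⟩
  have := closure_convexHull_extremePoints (S.finite_toSet.isCompact_convexHull (𝕜 := ℝ))
    (convex_convexHull ℝ _)
  rwa [hfin.isCompact_convexHull (𝕜 := ℝ) |>.isClosed.closure_eq] at this

theorem exists_mem_inner_le {E : Type*} [NormedAddCommGroup E] [InnerProductSpace ℝ E]
    {V : Set E} {x : E} (hx : x ∈ convexHull ℝ V) (y : E) : ∃ v ∈ V, ⟪y, x⟫ ≤ ⟪y, v⟫ := by
  by_contra! h
  have : convexHull ℝ V ⊆ {z | ⟪y, z⟫ < ⟪y, x⟫} := by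
    refine convexHull_min h ?_
    exact convex_halfSpace_lt (innerSL ℝ y).isLinear _
  exact lt_irrefl ⟪y, x⟫ (this hx)

open Finset in
/-- For random sign vectors `ε, ε'` whose rounded products with all `σ • u i` agree, `σ • (ε - ε')`
lies in the body cut out by `u`; comparing the number of such pairs with the exponential moments
of `⟪ε - ε', v⟫` over `v ∈ V` bounds `V.card` from below. -/
theorem exp_sq_le_card_mul_of_subset_convexHull {n m : ℕ} (u : Fin m → EuclideanSpace ℝ (Fin n))
    (V : Finset (EuclideanSpace ℝ (Fin n))) {R σ τ l : ℝ} (hu : ∀ i, ‖u i‖ ≤ 1)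
    (hV : ∀ v ∈ V, ‖v‖ ^ 2 ≤ R)
    (hK : {x : EuclideanSpace ℝ (Fin n) | ∀ i, |⟪x, u i⟫| ≤ 1} ⊆ convexHull ℝ (V : Set _))
    (hσ : 0 < σ) (hτ : 0 ≤ τ) (hτσ : 8 * (τ * σ) ≤ 1) (hl0 : 0 ≤ l)
    (hl : Real.exp (-(2 * l)) ≤ 1 / 2) :
    Real.exp (-(l * (m * (768 * σ ^ 4)))) ^ 2 ≤
      V.card * Real.exp (2 * τ ^ 2 * R - n * (τ * σ)) * (1 + 4 * Real.exp (-(2 * l))) ^ m := by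
  set b : (Fin n → Bool) → Fin m → ℤ :=
    fun ε i => round (σ * ∑ j, boolSign (ε j) * u i j)
  have hcard : (Fintype.card (Fin n → Bool) : ℝ) = 2 ^ n := by simp
  have hlow : (2 : ℝ) ^ n * Real.exp (-(l * (m * (768 * σ ^ 4)))) ≤
      ∑ ε, Real.exp (-(l * ∑ i, |(b ε i : ℝ)|)) := by
    rw [← hcard]
    refine card_mul_exp_le_sum_exp _ hl0 ?_
    rw [sum_comm, hcard]
    calc _ ≤ ∑ i : Fin m, (2 : ℝ) ^ n * (768 * σ ^ 4) := by
          refine sum_le_sum fun i _ => sum_abs_round_le (u i) ?_ σ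
          rw [← EuclideanSpace.real_norm_sq_eq]
          exact pow_le_one₀ (norm_nonneg _) (hu i)
      _ = _ := by simp; ring
  have hcol := sq_sum_exp_le_card_collisions b hl
  rw [Fintype.card_fin] at hcol
  have hup : (∑ ε, ∑ ε', if b ε = b ε' then (1 : ℝ) else 0) ≤
      V.card * (4 ^ n * Real.exp (2 * τ ^ 2 * R - n * (τ * σ))) := by
    calc _ ≤ ∑ ε : Fin n → Bool, ∑ ε' : Fin n → Bool, ∑ v ∈ V,
          Real.exp (∑ j, (τ * (v j * (boolSign (ε j) - boolSign (ε' j))) -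
            τ * σ * (boolSign (ε j) - boolSign (ε' j)) ^ 2)) := by
          refine sum_le_sum fun ε _ => sum_le_sum fun ε' _ => ?_
          split_ifs with h
          swap
          · positivity
          set d : EuclideanSpace ℝ (Fin n) :=
            WithLp.toLp 2 fun j => boolSign (ε j) - boolSign (ε' j)
          have hd : σ • d ∈ convexHull ℝ (V : Set (EuclideanSpace ℝ (Fin n))) := by
            refine hK fun i => ?_
            have h1 := abs_sub_round (σ * ∑ j, boolSign (ε j) * u i j)
            have h2 := abs_sub_round (σ * ∑ j, boolSign (ε' j) * u i j)
            have h3 : round (σ * ∑ j, boolSign (ε j) * u i j) =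
              round (σ * ∑ j, boolSign (ε' j) * u i j) := congrFun h i
            have h4 : ⟪σ • d, u i⟫ = σ * ∑ j, boolSign (ε j) * u i j -
                σ * ∑ j, boolSign (ε' j) * u i j := by
              rw [real_inner_smul_left, PiLp.inner_apply, ← mul_sub, ← sum_sub_distrib]
              simp only [d, RCLike.inner_apply, conj_trivial]
              congr 1
              exact sum_congr rfl fun j _ => by ring
            rw [h4]
            rw [h3] at h1
            rw [abs_le] at *
            constructor <;> linarith
          obtain ⟨v, hv, hdv⟩ := exists_mem_inner_le hd d
          refine le_trans ?_ (single_le_sum (fun v _ => (Real.exp_pos _).le) (mem_coe.1 hv))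
          apply Real.one_le_exp
          rw [real_inner_smul_right, real_inner_self_eq_norm_sq, EuclideanSpace.real_norm_sq_eq,
            PiLp.inner_apply] at hdv
          simp only [d, RCLike.inner_apply, conj_trivial] at hdv
          rw [sum_sub_distrib, ← mul_sum, ← mul_sum, mul_assoc, ← mul_sub]
          exact mul_nonneg hτ (by linarith)
      _ = ∑ v ∈ V, ∑ ε : Fin n → Bool, ∑ ε' : Fin n → Bool,
          Real.exp (∑ j, (τ * (v j * (boolSign (ε j) - boolSign (ε' j))) -
            τ * σ * (boolSign (ε j) - boolSign (ε' j)) ^ 2)) := by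
          simp_rw [sum_comm (s := V)]
      _ ≤ ∑ v ∈ V, (4 : ℝ) ^ n * Real.exp (2 * τ ^ 2 * R - n * (τ * σ)) := by
          refine sum_le_sum fun v hv => ?_
          refine (sum_sum_exp_boolSign_sub_le v (by positivity) hτσ).trans ?_
          have := hV v hv
          rw [EuclideanSpace.real_norm_sq_eq] at this
          gcongr
      _ = _ := by simp
  have h4 : (4 : ℝ) ^ n = (2 ^ n) ^ 2 := by rw [← pow_mul, mul_comm, pow_mul]; norm_num
  rw [h4] at hup
  have hpos : (0 : ℝ) < (2 ^ n) ^ 2 := by positivity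
  refine le_of_mul_le_mul_left ?_ hpos
  calc _ = ((2 : ℝ) ^ n * Real.exp (-(l * (m * (768 * σ ^ 4))))) ^ 2 := by rw [mul_pow]
    _ ≤ (∑ ε, Real.exp (-(l * ∑ i, |(b ε i : ℝ)|))) ^ 2 := by gcongr
    _ ≤ _ := hcol
    _ ≤ V.card * ((2 ^ n) ^ 2 * Real.exp (2 * τ ^ 2 * R - n * (τ * σ))) *
        (1 + 4 * Real.exp (-(2 * l))) ^ m := by gcongr
    _ = _ := by ring

/-- **Theorem 1.1** (Barvinok).  For every `α, β ≥ 1` there is `γ > 0`, independent of `n`,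
such that for all sufficiently large `n`: any polytope `P = conv S ⊆ ℝⁿ` that contains
`{x : |⟨x, uᵢ⟩| ≤ 1, i = 1,…,m}` with `‖uᵢ‖ ≤ 1` and `m ≤ αn`, and is contained in the ball
of radius `β√n`, has at least `exp(γn)` vertices (extreme points). -/
theorem stmt_0 (α β : ℝ) (hα : 1 ≤ α) (hβ : 1 ≤ β) :
    ∃ γ > (0 : ℝ), ∃ N : ℕ, ∀ n : ℕ, N ≤ n →
      ∀ (m : ℕ) (u : Fin m → EuclideanSpace ℝ (Fin n))
        (S : Finset (EuclideanSpace ℝ (Fin n))),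
        (∀ i, ‖u i‖ ≤ 1) → (m : ℝ) ≤ α * n →
        {x : EuclideanSpace ℝ (Fin n) | ∀ i, |⟪x, u i⟫| ≤ 1} ⊆
          convexHull ℝ (S : Set (EuclideanSpace ℝ (Fin n))) →
        convexHull ℝ (S : Set (EuclideanSpace ℝ (Fin n))) ⊆
          Metric.closedBall 0 (β * Real.sqrt n) →
        Real.exp (γ * n) ≤
          ((Set.extremePoints ℝ
            (convexHull ℝ (S : Set (EuclideanSpace ℝ (Fin n))))).ncard : ℝ) := by
  set σ : ℝ := 1 / (24640 * (α * β ^ 2)) with hσdef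
  have hαβ : 1 ≤ α * β ^ 2 := one_le_mul_of_one_le_of_one_le hα (one_le_pow₀ hβ)
  have hβ2 : 1 ≤ β ^ 2 := one_le_pow₀ hβ
  have hσ : 0 < σ := by positivity
  have hσ1 : σ ≤ 1 / 24640 := by
    rw [hσdef]; gcongr; linarith
  have hσαβ : 1540 * (α * σ) = 1 / (16 * β ^ 2) := by rw [hσdef]; field_simp; norm_num
  have hq : Real.exp (-(2 * (1 / σ))) ≤ σ ^ 3 := by
    rw [Real.exp_neg]
    refine inv_le_of_inv_le₀ (by positivity) ?_
    have h := Real.pow_div_factorial_le_exp (2 * (1 / σ)) (by positivity) 3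
    refine le_trans ?_ h
    have : (2 * (1 / σ)) ^ 3 / (Nat.factorial 3 : ℝ) = (8 / 6) * (σ ^ 3)⁻¹ := by
      norm_num [Nat.factorial]; field_simp; norm_num
    rw [this]
    have : 0 < (σ ^ 3)⁻¹ := by positivity
    linarith
  refine ⟨σ ^ 2 / (16 * β ^ 2), by positivity, 0, fun n _ m u S hu hm hK hP => ?_⟩
  obtain ⟨hfin, hhull⟩ := convexHull_extremePoints_of_finset S
  set E := Set.extremePoints ℝ (convexHull ℝ (S : Set (EuclideanSpace ℝ (Fin n))))
  rw [Set.ncard_eq_toFinset_card E hfin]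
  have hV : ∀ v ∈ hfin.toFinset, ‖v‖ ^ 2 ≤ β ^ 2 * n := by
    intro v hv
    have h := hP (extremePoints_subset (hfin.mem_toFinset.1 hv))
    rw [mem_closedBall_zero_iff] at h
    calc ‖v‖ ^ 2 ≤ (β * Real.sqrt n) ^ 2 := by gcongr
      _ = _ := by rw [mul_pow, Real.sq_sqrt (Nat.cast_nonneg n)]
  have hσ3 : σ ^ 3 ≤ 1 / 2 := by
    calc σ ^ 3 ≤ (1 / 24640) ^ 3 := by gcongr
      _ ≤ _ := by norm_num
  have hτσ : 8 * (σ / (4 * β ^ 2) * σ) ≤ 1 := by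
    have : σ / (4 * β ^ 2) ≤ σ := div_le_self hσ.le (by linarith)
    nlinarith
  have key := exp_sq_le_card_mul_of_subset_convexHull u hfin.toFinset (τ := σ / (4 * β ^ 2))
    (l := 1 / σ) hu hV (by rwa [hfin.coe_toFinset, hhull]) hσ (by positivity) hτσ (by positivity) (hq.trans hσ3)
  have hpow : (1 + 4 * Real.exp (-(2 * (1 / σ)))) ^ m ≤ Real.exp (4 * (α * n) * σ ^ 3) := by
    calc _ ≤ Real.exp (4 * σ ^ 3) ^ m := by
          gcongr
          have := Real.add_one_le_exp (4 * σ ^ 3)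
          linarith
      _ = Real.exp (4 * m * σ ^ 3) := by rw [← Real.exp_nat_mul]; ring_nf
      _ ≤ _ := by gcongr
  have hleft : Real.exp (-(1536 * (α * n) * σ ^ 3)) ≤
      Real.exp (-(1 / σ * (m * (768 * σ ^ 4)))) ^ 2 := by
    rw [← Real.exp_nat_mul]
    apply Real.exp_le_exp.2
    have e : ((2 : ℕ) : ℝ) * (-(1 / σ * (m * (768 * σ ^ 4)))) = -(1536 * m * σ ^ 3) := by
      field_simp; ring
    rw [e]
    gcongr
  have hfinal : Real.exp (-(1536 * (α * n) * σ ^ 3)) ≤ hfin.toFinset.card *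
      Real.exp (2 * (σ / (4 * β ^ 2)) ^ 2 * (β ^ 2 * n) - n * (σ / (4 * β ^ 2) * σ) +
        4 * (α * n) * σ ^ 3) := by
    rw [Real.exp_add, ← mul_assoc (hfin.toFinset.card : ℝ)]
    refine hleft.trans (key.trans ?_)
    gcongr
  rw [← div_le_iff₀ (Real.exp_pos _), ← Real.exp_sub] at hfinal
  refine le_of_eq_of_le (congrArg Real.exp ?_) hfinal
  have e1 : 2 * (σ / (4 * β ^ 2)) ^ 2 * (β ^ 2 * n) - n * (σ / (4 * β ^ 2) * σ) =
      -(2 * σ ^ 2 * n * (1 / (16 * β ^ 2))) := by field_simp; ring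
  have e2 : σ ^ 2 / (16 * β ^ 2) = σ ^ 2 * (1 / (16 * β ^ 2)) := by ring
  rw [e1, e2, ← hσαβ]
  ring
end

section
/- Let α, β ≥ 1, let 0 < ε < 1, and let ρ > 0 be a number satisfying both α·ln(1 − exp(−ρ²/2)) > −ε²/4 and γ := ((1−ε)²/(2β²ρ²))·(1 − exp(−ρ²/2)) + α·ln(1 − exp(−ρ²/2)) > 0. Then for all sufficiently large n the following holds: if P ⊂ ℝⁿ is a polytope containing {x ∈ ℝⁿ : |⟨x, uᵢ⟩| ≤ 1 for i = 1, …, m}, where ‖uᵢ‖ ≤ 1 for all i and m ≤ αn, and P is contained in the ball {x ∈ ℝⁿ : ‖x‖ ≤ β√n}, then P has at least exp(γn) vertices. -/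
open scoped RealInnerProductSpace

section

open MeasureTheory ProbabilityTheory Set
open scoped ENNReal Pointwise

/-- One-dimensional Brunn-Minkowski inequality. -/
theorem Real.volume_add_volume_le_of_add_subset {A B S : Set ℝ} (hA : MeasurableSet A)
    (hB : MeasurableSet B) (hA0 : A.Nonempty) (hB0 : B.Nonempty) (hS : A + B ⊆ S) :
    volume A + volume B ≤ volume S := by
  have key : ∀ K ⊆ A, IsCompact K → ∀ L ⊆ B, IsCompact L → volume K + volume L ≤ volume S := by
    intro K hKA hK L hLB hL
    obtain ⟨a, ha⟩ := hA0
    obtain ⟨b, hb⟩ := hB0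
    rcases K.eq_empty_or_nonempty with rfl | hK0
    · calc volume ∅ + volume L = volume ({a} + L) := by simp [singleton_add]
        _ ≤ volume S := measure_mono ((add_subset_add (by simpa using ha) hLB).trans hS)
    rcases L.eq_empty_or_nonempty with rfl | hL0
    · calc volume K + volume ∅ = volume (K + {b}) := by simp [add_singleton]
        _ ≤ volume S := measure_mono ((add_subset_add hKA (by simpa using hb)).trans hS)
    obtain ⟨k, hk⟩ := hK.exists_isGreatest hK0
    obtain ⟨l, hl⟩ := hL.exists_isLeast hL0
    have hdisj : AEDisjoint volume (K + {l}) ({k} + L) := by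
      refine measure_mono_null (t := {k + l}) ?_ (by simp)
      rintro x ⟨⟨p, hp, q, hq, rfl⟩, ⟨p', hp', q', hq', h⟩⟩
      simp only [mem_singleton_iff] at hq hp' ⊢
      subst hq hp'
      have := hk.2 hp
      have := hl.2 hq'
      simp only at h ⊢
      linarith
    calc volume K + volume L = volume (K + {l}) + volume ({k} + L) := by
          simp [singleton_add, add_singleton]
      _ = volume ((K + {l}) ∪ ({k} + L)) :=
          (measure_union₀ (isCompact_singleton.add hL).measurableSet.nullMeasurableSet hdisj).symm
      _ ≤ volume S := measure_mono ((union_subset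
          (add_subset_add hKA (by simpa using hLB hl.1))
          (add_subset_add (by simpa using hKA hk.1) hLB)).trans hS)
  rw [hA.measure_eq_iSup_isCompact, hB.measure_eq_iSup_isCompact]
  simp_rw [iSup_and']
  exact ENNReal.biSup_add_biSup_le' ⟨∅, empty_subset _, isCompact_empty⟩
    ⟨∅, empty_subset _, isCompact_empty⟩ fun K hK L hL ↦ key K hK.1 hK.2 L hL.1 hL.2

theorem add_integral_le_of_sup_eq_one {f g h : ℝ → ℝ} {a b : ℝ} (ha : 0 < a) (hb : 0 < b)
    (hf : Measurable f) (hg : Measurable g)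
    (hfi : Integrable f) (hgi : Integrable g) (hhi : Integrable h)
    (hf0 : 0 ≤ f) (hg0 : 0 ≤ g) (hh0 : 0 ≤ h) (hf1 : ∀ x, f x ≤ 1) (hg1 : ∀ x, g x ≤ 1)
    (hfs : ∀ t < 1, ∃ x, t < f x) (hgs : ∀ t < 1, ∃ x, t < g x)
    (H : ∀ x y t, 0 < t → t < f x → t < g y → t < h (a * x + b * y)) :
    a * (∫ x, f x) + b * (∫ x, g x) ≤ ∫ x, h x := by
  have layer : ∀ k : ℝ → ℝ, Integrable k → 0 ≤ k →
      ENNReal.ofReal (∫ x, k x) = ∫⁻ t in Ioi 0, volume {x | t < k x} := fun k hk hk0 ↦ by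
    rw [ofReal_integral_eq_lintegral_ofReal hk (.of_forall hk0)]
    exact lintegral_eq_lintegral_meas_lt _ (.of_forall hk0) hk.aemeasurable
  have meas : ∀ k : ℝ → ℝ, Measurable fun t : ℝ ↦ volume {x | t < k x} := fun k ↦
    Antitone.measurable fun s t hst ↦ measure_mono fun x hx ↦ hst.trans_lt hx
  have hIf : 0 ≤ ∫ x, f x := integral_nonneg hf0
  have hIg : 0 ≤ ∫ x, g x := integral_nonneg hg0
  rw [← ENNReal.ofReal_le_ofReal_iff (integral_nonneg hh0),
    ENNReal.ofReal_add (by positivity) (by positivity), ENNReal.ofReal_mul ha.le,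
    ENNReal.ofReal_mul hb.le, layer f hfi hf0, layer g hgi hg0, layer h hhi hh0,
    ← lintegral_const_mul _ (meas f), ← lintegral_const_mul _ (meas g),
    ← lintegral_add_left ((meas f).const_mul _)]
  refine setLIntegral_mono' measurableSet_Ioi fun t ht ↦ ?_
  rcases lt_or_ge t 1 with ht1 | ht1
  · have hs : ∀ (c : ℝ) (hc : 0 < c) (A : Set ℝ), ENNReal.ofReal c * volume A = volume (c • A) := by
      intro c hc A
      simp [Measure.addHaar_smul, abs_of_pos hc]
    rw [hs a ha, hs b hb]
    refine Real.volume_add_volume_le_of_add_subset ?_ ?_ ?_ ?_ ?_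
    · exact (measurableSet_lt measurable_const hf).const_smul₀ a
    · exact (measurableSet_lt measurable_const hg).const_smul₀ b
    · exact Set.Nonempty.smul_set (hfs t ht1)
    · exact Set.Nonempty.smul_set (hgs t ht1)
    · rintro _ ⟨_, ⟨x, hx, rfl⟩, _, ⟨y, hy, rfl⟩, rfl⟩
      exact H x y t ht hx hy
  · have h1 : {x | t < f x} = ∅ := eq_empty_of_forall_notMem fun x hx ↦
      (hx.trans_le (hf1 x)).not_ge ht1
    have h2 : {x | t < g x} = ∅ := eq_empty_of_forall_notMem fun x hx ↦
      (hx.trans_le (hg1 x)).not_ge ht1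
    simp [h1, h2]

/-- One-dimensional Prékopa-Leindler inequality for bounded functions. -/
theorem prekopa_leindler {f g h : ℝ → ℝ} {a b : ℝ} (ha : 0 < a) (hb : 0 < b) (hab : a + b = 1)
    (hf : Measurable f) (hg : Measurable g)
    (hfi : Integrable f) (hgi : Integrable g) (hhi : Integrable h)
    (hf0 : 0 ≤ f) (hg0 : 0 ≤ g) (hh0 : 0 ≤ h)
    (hfb : BddAbove (range f)) (hgb : BddAbove (range g))
    (H : ∀ x y, f x ^ a * g y ^ b ≤ h (a * x + b * y)) :
    (∫ x, f x) ^ a * (∫ x, g x) ^ b ≤ ∫ x, h x := by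
  have hIh : 0 ≤ ∫ x, h x := integral_nonneg hh0
  have sup_pos : ∀ k : ℝ → ℝ, 0 ≤ k → BddAbove (range k) → ∫ x, k x ≠ 0 → 0 < ⨆ x, k x := by
    intro k hk0 hkb hk
    by_contra! hle
    refine hk ?_
    have : k = 0 := funext fun x ↦ le_antisymm ((le_ciSup hkb x).trans hle) (hk0 x)
    simp [this]
  by_cases hf' : ∫ x, f x = 0
  · simpa [hf', Real.zero_rpow ha.ne'] using hIh
  by_cases hg' : ∫ x, g x = 0
  · simpa [hg', Real.zero_rpow hb.ne'] using hIh
  have hM := sup_pos f hf0 hfb hf'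
  have hN := sup_pos g hg0 hgb hg'
  set M := ⨆ x, f x
  set N := ⨆ x, g x
  have hC : 0 < M ^ a * N ^ b := by positivity
  have key := add_integral_le_of_sup_eq_one (f := fun x ↦ f x / M) (g := fun x ↦ g x / N)
    (h := fun x ↦ h x / (M ^ a * N ^ b)) ha hb (hf.div_const _) (hg.div_const _) (hfi.div_const _)
    (hgi.div_const _) (hhi.div_const _) (fun x ↦ div_nonneg (hf0 x) hM.le)
    (fun x ↦ div_nonneg (hg0 x) hN.le) (fun x ↦ div_nonneg (hh0 x) hC.le)
    (fun x ↦ (div_le_one hM).2 (le_ciSup hfb x)) (fun x ↦ (div_le_one hN).2 (le_ciSup hgb x))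
    (fun t ht ↦ by
      obtain ⟨x, hx⟩ := exists_lt_of_lt_ciSup (show t * M < ⨆ x, f x from by nlinarith)
      exact ⟨x, (lt_div_iff₀ hM).2 hx⟩)
    (fun t ht ↦ by
      obtain ⟨x, hx⟩ := exists_lt_of_lt_ciSup (show t * N < ⨆ x, g x from by nlinarith)
      exact ⟨x, (lt_div_iff₀ hN).2 hx⟩)
    (fun x y t ht hx hy ↦ by
      rw [lt_div_iff₀ hM] at hx
      rw [lt_div_iff₀ hN] at hy
      rw [lt_div_iff₀ hC]
      refine lt_of_lt_of_le ?_ (H x y)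
      calc t * (M ^ a * N ^ b) = (t * M) ^ a * (t * N) ^ b := by
            rw [Real.mul_rpow ht.le hM.le, Real.mul_rpow ht.le hN.le]
            nth_rewrite 1 [← Real.rpow_one t]
            rw [← hab, Real.rpow_add ht]
            ring
        _ < f x ^ a * g y ^ b := by
            gcongr)
  simp only [integral_div] at key
  have amgm := Real.geom_mean_le_arith_mean2_weighted ha.le hb.le
    (div_nonneg (integral_nonneg (μ := volume) hf0) hM.le)
    (div_nonneg (integral_nonneg (μ := volume) hg0) hN.le) hab
  have := amgm.trans key
  rw [Real.div_rpow (integral_nonneg hf0) hM.le, Real.div_rpow (integral_nonneg hg0) hN.le,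
    div_mul_div_comm] at this
  exact (div_le_div_iff_of_pos_right hC).1 this

/-- Log-concavity of a nonnegative function on a real vector space. -/
def IsLogConcave {V : Type*} [AddCommGroup V] [Module ℝ V] (F : V → ℝ) : Prop :=
  ∀ ⦃x y : V⦄ ⦃a b : ℝ⦄, 0 < a → 0 < b → a + b = 1 → F x ^ a * F y ^ b ≤ F (a • x + b • y)

theorem isLogConcave_gaussianPDFReal : IsLogConcave (gaussianPDFReal 0 1) := by
  intro x y a b ha hb hab
  have hc : 0 < (√(2 * Real.pi))⁻¹ := by positivity
  simp only [gaussianPDFReal, NNReal.coe_one, mul_one, sub_zero, smul_eq_mul]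
  rw [Real.mul_rpow hc.le (Real.exp_pos _).le, Real.mul_rpow hc.le (Real.exp_pos _).le,
    mul_mul_mul_comm, ← Real.rpow_add hc, hab, Real.rpow_one, ← Real.exp_mul, ← Real.exp_mul,
    ← Real.exp_add]
  gcongr
  obtain rfl : b = 1 - a := by linarith
  nlinarith [mul_nonneg (mul_pos ha hb).le (sq_nonneg (x - y))]

/-- Prékopa's theorem for the marginal along one Gaussian coordinate. -/
theorem IsLogConcave.integral_gaussianReal {V : Type*} [AddCommGroup V] [Module ℝ V]
    {F : V × ℝ → ℝ} (hF : IsLogConcave F) (h0 : ∀ p, 0 ≤ F p) (h1 : ∀ p, F p ≤ 1)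
    (hm : ∀ v, Measurable fun s ↦ F (v, s)) :
    IsLogConcave fun v ↦ ∫ s, F (v, s) ∂gaussianReal 0 1 := by
  intro x y a b ha hb hab
  have hφ0 : ∀ s, 0 ≤ gaussianPDFReal 0 1 s := gaussianPDFReal_nonneg 0 1
  have hφm : Measurable (gaussianPDFReal 0 1) := measurable_gaussianPDFReal 0 1
  have hφb : ∀ s, gaussianPDFReal 0 1 s ≤ (√(2 * Real.pi))⁻¹ := fun s ↦ by
    simp only [gaussianPDFReal, NNReal.coe_one, mul_one, sub_zero]
    refine mul_le_of_le_one_right (by positivity) (Real.exp_le_one_iff.2 ?_)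
    nlinarith [sq_nonneg s]
  have hint : ∀ v, Integrable fun s ↦ gaussianPDFReal 0 1 s * F (v, s) := fun v ↦
    (integrable_gaussianPDFReal 0 1).mul_bdd (c := 1) (hm v).aestronglyMeasurable
      (.of_forall fun s ↦ by rw [Real.norm_of_nonneg (h0 _)]; exact h1 _)
  have hbdd : ∀ v, BddAbove (range fun s ↦ gaussianPDFReal 0 1 s * F (v, s)) := by
    rintro v
    refine ⟨(√(2 * Real.pi))⁻¹, ?_⟩
    rintro _ ⟨s, rfl⟩
    exact (mul_le_of_le_one_right (hφ0 s) (h1 _)).trans (hφb s)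
  simp only [integral_gaussianReal_eq_integral_smul one_ne_zero, smul_eq_mul]
  refine prekopa_leindler ha hb hab (hφm.mul (hm x)) (hφm.mul (hm y)) (hint x) (hint y) (hint _)
    (fun s ↦ mul_nonneg (hφ0 s) (h0 _)) (fun s ↦ mul_nonneg (hφ0 s) (h0 _))
    (fun s ↦ mul_nonneg (hφ0 s) (h0 _)) (hbdd x) (hbdd y) fun s t ↦ ?_
  rw [Real.mul_rpow (hφ0 s) (h0 _), Real.mul_rpow (hφ0 t) (h0 _), mul_mul_mul_comm]
  exact mul_le_mul (isLogConcave_gaussianPDFReal ha hb hab) (hF ha hb hab)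
    (mul_nonneg (Real.rpow_nonneg (h0 _) _) (Real.rpow_nonneg (h0 _) _)) (hφ0 _)

/-- The standard Gaussian measure on `Fin k → ℝ`. -/
noncomputable abbrev piGaussian (k : ℕ) : Measure (Fin k → ℝ) :=
  Measure.pi fun _ ↦ gaussianReal 0 1

theorem integral_piGaussian_succ {k : ℕ} {f : (Fin (k + 1) → ℝ) → ℝ} (hf : Measurable f)
    (h0 : ∀ p, 0 ≤ f p) (h1 : ∀ p, f p ≤ 1) :
    ∫ z, f z ∂piGaussian (k + 1) =
      ∫ s, ∫ y, f (Fin.cons s y) ∂piGaussian k ∂gaussianReal 0 1 := by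
  have e := (measurePreserving_piFinSuccAbove (fun _ : Fin (k + 1) ↦ gaussianReal 0 1) 0).symm
  rw [← e.integral_comp', integral_prod]
  · simp [MeasurableEquiv.piFinSuccAbove]
    rfl
  · refine Integrable.of_bound (C := 1) ?_ (.of_forall fun p ↦ ?_)
    · exact (hf.comp (MeasurableEquiv.measurable _)).aestronglyMeasurable
    · rw [Real.norm_of_nonneg (h0 _)]; exact h1 _

theorem measurable_finCons {k : ℕ} :
    Measurable fun p : ℝ × (Fin k → ℝ) ↦ (Fin.cons p.1 p.2 : Fin (k + 1) → ℝ) := by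
  refine measurable_pi_iff.2 fun i ↦ ?_
  refine Fin.cases ?_ (fun j ↦ ?_) i
  · simpa using measurable_fst
  · simpa using! (measurable_pi_apply j).comp measurable_snd

theorem measurable_integral_piGaussian_cons {k : ℕ} {f : (Fin (k + 1) → ℝ) → ℝ}
    (hf : Measurable f) : Measurable fun s : ℝ ↦ ∫ y, f (Fin.cons s y) ∂piGaussian k := by
  have : StronglyMeasurable fun p : ℝ × (Fin k → ℝ) ↦ f (Fin.cons p.1 p.2) :=
    (hf.comp measurable_finCons).stronglyMeasurable
  exact this.integral_prod_right.measurable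

/-- Prékopa's theorem for Gaussian marginals. -/
theorem IsLogConcave.integral_piGaussian (k : ℕ) : ∀ {V : Type} [AddCommGroup V] [Module ℝ V]
    {F : V × (Fin k → ℝ) → ℝ}, IsLogConcave F → (∀ p, 0 ≤ F p) → (∀ p, F p ≤ 1) →
    (∀ v, Measurable fun s ↦ F (v, s)) → IsLogConcave fun v ↦ ∫ s, F (v, s) ∂piGaussian k := by
  induction k with
  | zero =>
    intro V _ _ F hF h0 h1 hm x y a b ha hb hab
    simp only [integral_unique, probReal_univ, one_smul]
    exact (hF ha hb hab).trans_eq (congrArg F (Prod.ext rfl (Subsingleton.elim _ _)))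
  | succ k ih =>
    intro V _ _ F hF h0 h1 hm
    have key := ih (V := V × ℝ) (F := fun p ↦ F (p.1.1, Fin.cons p.1.2 p.2)) ?_
      (fun _ ↦ h0 _) (fun _ ↦ h1 _) (fun v ↦ (hm v.1).comp (measurable_finCons.comp (measurable_prodMk_left (x := v.2))))
    · simp_rw [integral_piGaussian_succ (hm _) (fun _ ↦ h0 _) (fun _ ↦ h1 _)]
      refine key.integral_gaussianReal (fun p ↦ integral_nonneg fun _ ↦ h0 _) (fun p ↦ ?_)
        (fun v ↦ measurable_integral_piGaussian_cons (hm v))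
      have : ∫ _, (1 : ℝ) ∂piGaussian k = 1 := by simp
      exact (integral_mono_of_nonneg (.of_forall fun _ ↦ h0 _) (integrable_const _)
        (.of_forall fun _ ↦ h1 _)).trans this.le
    · rintro ⟨⟨v, s⟩, y⟩ ⟨⟨w, t⟩, z⟩ a b ha hb hab
      refine (hF ha hb hab).trans (le_of_eq ?_)
      congr 1
      refine Prod.ext rfl (funext fun i ↦ ?_)
      refine Fin.cases ?_ (fun j ↦ ?_) i <;> simp

theorem IsLogConcave.le_of_abs_le {f : ℝ → ℝ} (hf : IsLogConcave f) (h0 : ∀ s, 0 ≤ f s)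
    (heven : ∀ s, f (-s) = f s) {s t : ℝ} (hst : |s| ≤ |t|) : f t ≤ f s := by
  rcases hst.eq_or_lt with h | h
  · rcases abs_eq_abs.1 h with rfl | rfl
    · rfl
    · exact (heven t).ge
  · have ht : 0 < |t| := (abs_nonneg s).trans_lt h
    have hst1 : |s / t| < 1 := by rwa [abs_div, div_lt_one ht]
    obtain ⟨h1, h2⟩ := abs_lt.1 hst1
    have ha : 0 < (1 + s / t) / 2 := by linarith
    have hb : 0 < (1 - s / t) / 2 := by linarith
    have hab : (1 + s / t) / 2 + (1 - s / t) / 2 = 1 := by ring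
    have key := hf (x := t) (y := -t) ha hb hab
    rw [heven, ← Real.rpow_add_of_nonneg (h0 t) ha.le hb.le, hab, Real.rpow_one] at key
    refine key.trans_eq (congrArg f ?_)
    have : t ≠ 0 := abs_pos.1 ht
    simp only [smul_eq_mul]
    field_simp
    ring

/-- A function that decreases with `|s|` is positively correlated with a symmetric interval. -/
theorem measureReal_Icc_mul_integral_le {ν : Measure ℝ} [IsProbabilityMeasure ν] {f : ℝ → ℝ}
    (hfi : Integrable f ν) (hf : ∀ s t, |s| ≤ |t| → f t ≤ f s) {ρ : ℝ} (hρ : 0 ≤ ρ) :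
    ν.real (Icc (-ρ) ρ) * ∫ s, f s ∂ν ≤ ∫ s in Icc (-ρ) ρ, f s ∂ν := by
  have hI : MeasurableSet (Icc (-ρ) ρ) := measurableSet_Icc
  have hon : ν.real (Icc (-ρ) ρ) * f ρ ≤ ∫ s in Icc (-ρ) ρ, f s ∂ν := by
    rw [← smul_eq_mul, ← setIntegral_const]
    refine setIntegral_mono_on (integrable_const _).integrableOn hfi.integrableOn hI fun s hs ↦ ?_
    exact hf s ρ (by rw [abs_of_nonneg hρ]; exact abs_le.2 hs)
  have hoff : ∫ s in (Icc (-ρ) ρ)ᶜ, f s ∂ν ≤ ν.real (Icc (-ρ) ρ)ᶜ * f ρ := by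
    rw [← smul_eq_mul, ← setIntegral_const]
    refine setIntegral_mono_on hfi.integrableOn (integrable_const _).integrableOn hI.compl
      fun s hs ↦ ?_
    exact hf ρ s (by rw [abs_of_nonneg hρ]; exact (not_le.1 fun h ↦ hs (abs_le.1 h)).le)
  rw [probReal_compl_eq_one_sub hI] at hoff
  rw [← integral_add_compl hI hfi]
  have h1 : ν.real (Icc (-ρ) ρ) ≤ 1 := measureReal_le_one
  have h0 : 0 ≤ ν.real (Icc (-ρ) ρ) := measureReal_nonneg
  nlinarith [mul_le_mul_of_nonneg_left hoff h0, mul_le_mul_of_nonneg_left hon (sub_nonneg.2 h1)]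

theorem integral_piGaussian_neg {k : ℕ} (f : (Fin k → ℝ) → ℝ) :
    ∫ y, f (-y) ∂piGaussian k = ∫ y, f y ∂piGaussian k := by
  have h : MeasurePreserving (fun y : Fin k → ℝ ↦ fun i ↦ -y i) (piGaussian k) (piGaussian k) :=
    measurePreserving_pi _ _ fun _ ↦
      ⟨measurable_neg, by simpa using! gaussianReal_map_neg (μ := 0) (v := 1)⟩
  exact h.integral_comp (MeasurableEquiv.neg (Fin k → ℝ)).measurableEmbedding f

theorem isLogConcave_indicator {V : Type*} [AddCommGroup V] [Module ℝ V] {K : Set V}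
    (hK : Convex ℝ K) : IsLogConcave (K.indicator fun _ ↦ (1 : ℝ)) := by
  intro x y a b ha hb hab
  by_cases hx : x ∈ K
  · by_cases hy : y ∈ K
    · simp [hx, hy, hK hx hy ha.le hb.le hab]
    · rw [indicator_of_notMem hy, Real.zero_rpow hb.ne', mul_zero]
      exact indicator_nonneg (fun _ _ ↦ zero_le_one) _
  · rw [indicator_of_notMem hx, Real.zero_rpow ha.ne', zero_mul]
    exact indicator_nonneg (fun _ _ ↦ zero_le_one) _

/-- **Šidák's inequality** in coordinates. -/
theorem piGaussian_slab_mul_le {k : ℕ} {K : Set (Fin (k + 1) → ℝ)} (hK : Convex ℝ K)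
    (hKm : MeasurableSet K) (hKs : ∀ x ∈ K, -x ∈ K) {ρ : ℝ} (hρ : 0 ≤ ρ) :
    (gaussianReal 0 1).real (Icc (-ρ) ρ) * (piGaussian (k + 1)).real K ≤
      (piGaussian (k + 1)).real (K ∩ {x | |x 0| ≤ ρ}) := by
  set F : (Fin (k + 1) → ℝ) → ℝ := K.indicator fun _ ↦ 1 with hF
  have hFm : Measurable F := measurable_const.indicator hKm
  have hF0 : ∀ x, 0 ≤ F x := indicator_nonneg fun _ _ ↦ zero_le_one
  have hF1 : ∀ x, F x ≤ 1 := indicator_le_self' (fun _ _ ↦ zero_le_one)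
  have hFs : ∀ x, F (-x) = F x := fun x ↦ by
    have : -x ∈ K ↔ x ∈ K := ⟨fun h ↦ by simpa using hKs _ h, hKs x⟩
    by_cases h : x ∈ K <;> simp [hF, h, this]
  set f : ℝ → ℝ := fun s ↦ ∫ y, F (Fin.cons s y) ∂piGaussian k with hf
  have hf0 : ∀ s, 0 ≤ f s := fun s ↦ integral_nonneg fun _ ↦ hF0 _
  have hf1 : ∀ s, f s ≤ 1 := fun s ↦ by
    have : ∫ _, (1 : ℝ) ∂piGaussian k = 1 := by simp
    exact (integral_mono_of_nonneg (.of_forall fun _ ↦ hF0 _) (integrable_const _)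
      (.of_forall fun _ ↦ hF1 _)).trans this.le
  have hneg : ∀ s (y : Fin k → ℝ), (Fin.cons (-s) (-y) : Fin (k + 1) → ℝ) = -Fin.cons s y := by
    intro s y
    ext i
    refine Fin.cases ?_ (fun j ↦ ?_) i <;> simp
  have hfeven : ∀ s, f (-s) = f s := fun s ↦ by
    simp only [hf]
    rw [← integral_piGaussian_neg]
    simp_rw [hneg, hFs]
  have hflc : IsLogConcave f := by
    refine IsLogConcave.integral_piGaussian k (F := fun p : ℝ × (Fin k → ℝ) ↦ F (Fin.cons p.1 p.2))
      ?_ (fun _ ↦ hF0 _) (fun _ ↦ hF1 _)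
      fun v ↦ hFm.comp (measurable_finCons.comp (measurable_prodMk_left (x := v)))
    intro p q a b ha hb hab
    refine (isLogConcave_indicator hK ha hb hab).trans (le_of_eq (congrArg F (funext fun i ↦ ?_)))
    refine Fin.cases ?_ (fun j ↦ ?_) i <;> simp
  have hfi : Integrable f (gaussianReal 0 1) :=
    Integrable.of_bound (C := 1) (measurable_integral_piGaussian_cons hFm).aestronglyMeasurable
      (.of_forall fun s ↦ by rw [Real.norm_of_nonneg (hf0 _)]; exact hf1 _)
  have hS : MeasurableSet {x : Fin (k + 1) → ℝ | |x 0| ≤ ρ} :=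
    measurableSet_le (by fun_prop) measurable_const
  have e1 : (piGaussian (k + 1)).real K = ∫ s, f s ∂gaussianReal 0 1 := by
    rw [← integral_indicator_one hKm]
    exact integral_piGaussian_succ hFm hF0 hF1
  have e2 : (piGaussian (k + 1)).real (K ∩ {x | |x 0| ≤ ρ}) =
      ∫ s in Icc (-ρ) ρ, f s ∂gaussianReal 0 1 := by
    rw [← integral_indicator_one (hKm.inter hS)]
    refine (integral_piGaussian_succ (measurable_const.indicator (hKm.inter hS))
      (indicator_nonneg fun _ _ ↦ zero_le_one)
      (indicator_le_self' fun _ _ ↦ zero_le_one)).trans ?_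
    rw [← integral_indicator measurableSet_Icc]
    refine integral_congr_ae (.of_forall fun s ↦ ?_)
    by_cases hs : s ∈ Icc (-ρ) ρ
    · have : |s| ≤ ρ := abs_le.2 hs
      rw [indicator_of_mem hs]
      refine integral_congr_ae (.of_forall fun y ↦ ?_)
      by_cases h : (Fin.cons s y : Fin (k + 1) → ℝ) ∈ K
      · have h' : (Fin.cons s y : Fin (k + 1) → ℝ) ∈ K ∩ {x | |x 0| ≤ ρ} := ⟨h, by simpa using this⟩
        simp only [hF, indicator_of_mem h, indicator_of_mem h']
      · have h' : (Fin.cons s y : Fin (k + 1) → ℝ) ∉ K ∩ {x | |x 0| ≤ ρ} := fun h' ↦ h h'.1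
        simp only [hF, indicator_of_notMem h, indicator_of_notMem h']
    · have : ¬ |s| ≤ ρ := fun h ↦ hs (abs_le.1 h)
      rw [indicator_of_notMem hs]
      refine (integral_congr_ae (.of_forall fun y ↦ ?_)).trans (integral_zero _ _)
      exact indicator_of_notMem (fun h ↦ this (by simpa using h.2)) _
  rw [e1, e2]
  exact measureReal_Icc_mul_integral_le hfi (fun s t ↦ hflc.le_of_abs_le hf0 hfeven) hρ

section StdGaussian

variable {E : Type*} [NormedAddCommGroup E] [InnerProductSpace ℝ E] [FiniteDimensional ℝ E]
  [MeasurableSpace E] [BorelSpace E]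

/-- **Šidák's inequality**: a slab and a symmetric closed convex set are positively correlated
under the standard Gaussian measure. -/
theorem stdGaussian_slab_mul_le {K : Set E} (hK : Convex ℝ K) (hKc : IsClosed K)
    (hKs : ∀ x ∈ K, -x ∈ K) {e : E} (he : ‖e‖ = 1) {ρ : ℝ} (hρ : 0 ≤ ρ) :
    (gaussianReal 0 1).real (Icc (-ρ) ρ) * (stdGaussian E).real K ≤
      (stdGaussian E).real (K ∩ {x | |⟪x, e⟫| ≤ ρ}) := by
  obtain ⟨k, hk⟩ : ∃ k, Module.finrank ℝ E = k + 1 := by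
    have : Nontrivial E := ⟨e, 0, fun h ↦ by simp [h] at he⟩
    exact Nat.exists_eq_succ_of_ne_zero Module.finrank_pos.ne'
  obtain ⟨b, hb⟩ := Orthonormal.exists_orthonormalBasis_extension_of_card_eq (𝕜 := ℝ)
    (ι := Fin (k + 1)) (by simpa using hk) (v := fun _ ↦ e) (s := {0})
    ⟨fun i ↦ he, fun i j hij ↦ (hij (Subsingleton.elim _ _)).elim⟩
  have hb0 : b 0 = e := hb 0 rfl
  let T : (Fin (k + 1) → ℝ) →ₗ[ℝ] E := Fintype.linearCombination ℝ b
  have hT : ∀ x, T x = ∑ i, x i • b i := fun x ↦ Fintype.linearCombination_apply ℝ b x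
  have hTm : Measurable T := T.continuous_of_finiteDimensional.measurable
  have hS : MeasurableSet {x : E | |⟪x, e⟫| ≤ ρ} :=
    measurableSet_le (by fun_prop) measurable_const
  have hin : ∀ x, ⟪T x, e⟫ = x 0 := fun x ↦ by
    rw [hT, ← hb0, sum_inner]
    simp [real_inner_smul_left, b.inner_eq_ite]
  have hmap : stdGaussian E = (piGaussian (k + 1)).map T := by
    rw [stdGaussian_eq_map_pi_orthonormalBasis b]
    congr 1
  rw [hmap, map_measureReal_apply hTm hKc.measurableSet,
    map_measureReal_apply hTm (hKc.measurableSet.inter hS)]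
  have := piGaussian_slab_mul_le (hK.linear_preimage T) (hTm hKc.measurableSet)
    (fun x hx ↦ by simpa using hKs _ hx) hρ
  simpa [preimage_inter, preimage_ofPred_eq, hin] using this

end StdGaussian

theorem gaussianReal_real_Ioi_le {ρ : ℝ} (hρ : 0 ≤ ρ) :
    (gaussianReal 0 1).real (Ioi ρ) ≤
      Real.exp (-(ρ ^ 2) / 2) * (gaussianReal 0 1).real (Ioi 0) := by
  have h : ∀ m : ℝ, (gaussianReal m 1).real (Ioi 0) = ∫ x in Ioi 0, gaussianPDFReal m 1 x :=
    fun m ↦ by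
      rw [measureReal_def, gaussianReal_apply_eq_integral _ one_ne_zero, ENNReal.toReal_ofReal]
      exact integral_nonneg fun _ ↦ gaussianPDFReal_nonneg _ _ _
  have hshift : (gaussianReal 0 1).real (Ioi ρ) = (gaussianReal (-ρ) 1).real (Ioi 0) := by
    rw [← zero_sub ρ, ← gaussianReal_map_sub_const, map_measureReal_apply (by fun_prop)
      measurableSet_Ioi]
    congr 1
    ext x
    simp
  rw [hshift, h, h, ← integral_const_mul]
  refine setIntegral_mono_on (integrable_gaussianPDFReal _ _).integrableOn
    ((integrable_gaussianPDFReal _ _).const_mul _).integrableOn measurableSet_Ioi fun x hx ↦ ?_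
  simp only [gaussianPDFReal, NNReal.coe_one, mul_one, sub_zero]
  rw [mul_left_comm, ← Real.exp_add]
  gcongr
  nlinarith [mul_nonneg hρ (le_of_lt hx)]

theorem one_sub_exp_le_gaussianReal_real_Icc {ρ : ℝ} (hρ : 0 ≤ ρ) :
    1 - Real.exp (-(ρ ^ 2) / 2) ≤ (gaussianReal 0 1).real (Icc (-ρ) ρ) := by
  have hneg : ∀ r : ℝ, (gaussianReal 0 1).real (Iio (-r)) = (gaussianReal 0 1).real (Ioi r) :=
    fun r ↦ by
      have : (gaussianReal 0 1).map (fun x ↦ -x) = gaussianReal 0 1 := by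
        rw [gaussianReal_map_neg, neg_zero]
      conv_lhs => rw [← this]
      rw [map_measureReal_apply measurable_neg measurableSet_Iio]
      congr 1
      ext x
      simp
  have hhalf : (gaussianReal 0 1).real (Ioi 0) + (gaussianReal 0 1).real (Ioi 0) ≤ 1 := by
    nth_rewrite 1 [← hneg 0]
    rw [neg_zero, ← measureReal_union (by
      rw [Set.disjoint_left]; intro x (hx : x < 0) (hx' : 0 < x); exact hx.not_gt hx')
      measurableSet_Ioi]
    exact measureReal_le_one
  have hcompl : (Icc (-ρ) ρ)ᶜ ⊆ Iio (-ρ) ∪ Ioi ρ := by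
    intro x hx
    by_contra h
    simp only [mem_union, mem_Iio, mem_Ioi, not_or, not_lt] at h
    exact hx h
  have h1 := (measureReal_mono (μ := gaussianReal 0 1) hcompl).trans (measureReal_union_le _ _)
  rw [probReal_compl_eq_one_sub measurableSet_Icc, hneg] at h1
  have h2 := gaussianReal_real_Ioi_le hρ
  have h3 := Real.exp_pos (-(ρ ^ 2) / 2)
  nlinarith

section StdGaussian

variable {E : Type*} [NormedAddCommGroup E] [InnerProductSpace ℝ E] [FiniteDimensional ℝ E]
  [MeasurableSpace E] [BorelSpace E]

theorem pow_card_le_stdGaussian_real_slabs {ι : Type*} (u : ι → E) (hu : ∀ i, ‖u i‖ ≤ 1) {ρ : ℝ}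
    (hρ : 0 ≤ ρ) (s : Finset ι) :
    (1 - Real.exp (-(ρ ^ 2) / 2)) ^ s.card ≤
      (stdGaussian E).real {x | ∀ i ∈ s, |⟪x, u i⟫| ≤ ρ} := by
  classical
  have hq : 0 ≤ 1 - Real.exp (-(ρ ^ 2) / 2) := by
    rw [sub_nonneg, Real.exp_le_one_iff]
    nlinarith [sq_nonneg ρ]
  induction s using Finset.induction_on with
  | empty => simp
  | insert j s hj ih =>
    set K := {x : E | ∀ i ∈ s, |⟪x, u i⟫| ≤ ρ} with hK
    have hKeq : K = ⋂ i ∈ s, (fun x ↦ ⟪x, u i⟫) ⁻¹' Icc (-ρ) ρ := by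
      ext x
      simp [hK, abs_le]
    have hconv : Convex ℝ K := by
      rw [hKeq]
      refine convex_iInter₂ fun i _ ↦ ?_
      have := (convex_Icc (𝕜 := ℝ) (-ρ) ρ).linear_preimage (innerₛₗ ℝ (u i))
      convert this using 1
      ext x
      simp [real_inner_comm]
    have hclosed : IsClosed K := by
      rw [hKeq]
      exact isClosed_biInter fun i _ ↦ isClosed_Icc.preimage (by fun_prop)
    have hsymm : ∀ x ∈ K, -x ∈ K := fun x hx i hi ↦ by simpa using hx i hi
    rw [Finset.card_insert_of_notMem hj, pow_succ]
    by_cases hj0 : u j = 0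
    · have : {x : E | ∀ i ∈ insert j s, |⟪x, u i⟫| ≤ ρ} = K := by
        ext x
        simp [hK, hj0, hρ]
      rw [this]
      refine (mul_le_of_le_one_right (pow_nonneg hq _) ?_).trans ih
      linarith [Real.exp_pos (-(ρ ^ 2) / 2)]
    · have hpos : 0 < ‖u j‖ := norm_pos_iff.2 hj0
      have he : ‖(‖u j‖⁻¹ • u j)‖ = 1 := norm_smul_inv_norm (𝕜 := ℝ) hj0
      calc _ ≤ (stdGaussian E).real K * (gaussianReal 0 1).real (Icc (-ρ) ρ) :=
            mul_le_mul ih (one_sub_exp_le_gaussianReal_real_Icc hρ) hq measureReal_nonneg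
        _ = (gaussianReal 0 1).real (Icc (-ρ) ρ) * (stdGaussian E).real K := mul_comm _ _
        _ ≤ _ := stdGaussian_slab_mul_le hconv hclosed hsymm he hρ
        _ ≤ _ := by
            refine measureReal_mono ?_
            rintro x ⟨hx, hxj⟩ i hi
            rcases Finset.mem_insert.1 hi with rfl | hi
            · have hxi : |⟪x, ‖u i‖⁻¹ • u i⟫| ≤ ρ := hxj
              rw [real_inner_smul_right, abs_mul, abs_of_pos (inv_pos.2 hpos)] at hxi
              refine le_trans (le_mul_of_one_le_left (abs_nonneg _) ?_) hxi
              exact (one_le_inv₀ hpos).2 (hu i)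
            · exact hx i hi

theorem stdGaussian_real_le_inner {v : E} {c t : ℝ} (hc : 0 < c) (hv : ‖v‖ ^ 2 ≤ c) (ht : 0 ≤ t) :
    (stdGaussian E).real {x | t ≤ ⟪x, v⟫} ≤ Real.exp (-(t ^ 2 / (2 * c))) := by
  have hmap : (stdGaussian E).map (fun x ↦ ⟪x, v⟫) = gaussianReal 0 (‖v‖ ^ 2).toNNReal := by
    have h := IsGaussian.map_eq_gaussianReal (μ := stdGaussian E) (innerSL ℝ v)
    rw [integral_strongDual_stdGaussian, variance_dual_stdGaussian, innerSL_apply_norm] at h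
    rw [← h]
    congr 1
    ext x
    simp [real_inner_comm]
  have hint : Integrable (fun x ↦ Real.exp (t / c * ⟪x, v⟫)) (stdGaussian E) := by
    have := integrable_exp_mul_gaussianReal (μ := 0) (v := (‖v‖ ^ 2).toNNReal) (t / c)
    rw [← hmap, integrable_map_measure (by fun_prop) (by fun_prop)] at this
    exact this
  refine (measure_ge_le_exp_mul_mgf t (div_nonneg ht hc.le) hint).trans ?_
  rw [mgf_gaussianReal hmap, ← Real.exp_add]
  gcongr
  rw [Real.coe_toNNReal _ (sq_nonneg _)]
  have : ‖v‖ ^ 2 * (t / c) ^ 2 ≤ c * (t / c) ^ 2 := by gcongr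
  have e1 : c * (t / c) ^ 2 = t ^ 2 / c := by field_simp
  have e2 : t ^ 2 / (2 * c) = t ^ 2 / c / 2 := by field_simp
  have e3 : t / c * t = t ^ 2 / c := by ring
  linarith [neg_mul (t / c) t]

end StdGaussian

theorem integral_exp_mul_sq_gaussianReal {t : ℝ} (ht : t < 1 / 2) :
    ∫ x, Real.exp (t * x ^ 2) ∂gaussianReal 0 1 = (√(1 - 2 * t))⁻¹ := by
  rw [integral_gaussianReal_eq_integral_smul one_ne_zero]
  have : ∀ x : ℝ, gaussianPDFReal 0 1 x • Real.exp (t * x ^ 2) =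
      (√(2 * Real.pi))⁻¹ * Real.exp (-(1 / 2 - t) * x ^ 2) := fun x ↦ by
    simp only [gaussianPDFReal, NNReal.coe_one, mul_one, sub_zero, smul_eq_mul]
    rw [mul_assoc, ← Real.exp_add]
    ring_nf
  simp_rw [this]
  rw [integral_const_mul, integral_gaussian, ← Real.sqrt_inv, ← Real.sqrt_inv, ← Real.sqrt_mul
    (by positivity)]
  congr 1
  have : 1 / 2 - t ≠ 0 := by linarith
  have : 1 - 2 * t ≠ 0 := by linarith
  field_simp

theorem one_sub_le_exp_neg_add_sq {x : ℝ} (h0 : 0 ≤ x) (h1 : x < 1) :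
    1 - x ≤ Real.exp (-(x + x ^ 2 / 2)) := by
  rw [← Real.log_le_iff_le_exp (by linarith)]
  have h := sum_le_hasSum (Finset.range 2) (fun i _ ↦ by positivity)
    (Real.hasSum_pow_div_log_of_abs_lt_one (x := x) (by rwa [abs_of_nonneg h0]))
  norm_num [Finset.sum_range_succ] at h
  linarith

theorem stdGaussian_real_norm_sq_le {n : ℕ} {ε : ℝ} (h0 : 0 ≤ ε) (h1 : ε < 1) :
    (stdGaussian (EuclideanSpace ℝ (Fin n))).real {x | ‖x‖ ^ 2 ≤ (1 - ε) * n} ≤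
      Real.exp (-(ε ^ 2 / 4) * n) := by
  have h1' : 0 < 1 - ε := by linarith
  set t : ℝ := -(ε / (2 * (1 - ε))) with ht
  have ht0 : t ≤ 0 := neg_nonpos.2 (by positivity)
  have hint : Integrable (fun x : EuclideanSpace ℝ (Fin n) ↦ Real.exp (t * ‖x‖ ^ 2))
      (stdGaussian (EuclideanSpace ℝ (Fin n))) := by
    refine Integrable.of_bound (C := 1) (by fun_prop) (.of_forall fun x ↦ ?_)
    rw [Real.norm_of_nonneg (Real.exp_pos _).le, Real.exp_le_one_iff]
    exact mul_nonpos_of_nonpos_of_nonneg ht0 (sq_nonneg _)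
  have hmgf : mgf (fun x : EuclideanSpace ℝ (Fin n) ↦ ‖x‖ ^ 2)
      (stdGaussian (EuclideanSpace ℝ (Fin n))) t = √(1 - ε) ^ n := by
    rw [mgf, ← map_pi_eq_stdGaussian, integral_map (by fun_prop) (by fun_prop)]
    simp_rw [EuclideanSpace.real_norm_sq_eq, Finset.mul_sum, Real.exp_sum]
    rw [integral_fintype_prod_eq_pow (fun x : ℝ ↦ Real.exp (t * x ^ 2)),
      integral_exp_mul_sq_gaussianReal (by linarith), Fintype.card_fin, ← Real.sqrt_inv]
    congr 2
    rw [ht]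
    field_simp
    ring
  refine (measure_le_le_exp_mul_mgf ((1 - ε) * n) ht0 hint).trans ?_
  have hsqrt : √(1 - ε) ≤ Real.exp (-(ε / 2 + ε ^ 2 / 4)) := by
    rw [Real.sqrt_le_left (Real.exp_pos _).le, ← Real.exp_nat_mul]
    refine (one_sub_le_exp_neg_add_sq h0 h1).trans_eq (congrArg _ ?_)
    push_cast
    ring
  rw [hmgf]
  calc _ ≤ Real.exp (-t * ((1 - ε) * n)) * Real.exp (-(ε / 2 + ε ^ 2 / 4)) ^ n := by gcongr
    _ = _ := by
      rw [← Real.exp_nat_mul, ← Real.exp_add, ht]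
      congr 1
      field_simp
      ring

/-- The Minkowski theorem: a polytope is the convex hull of its vertices. -/
theorem Set.Finite.convexHull_extremePoints {E : Type*} [NormedAddCommGroup E] [NormedSpace ℝ E]
    {S : Set E} (hS : S.Finite) :
    convexHull ℝ ((convexHull ℝ S).extremePoints ℝ) = convexHull ℝ S := by
  have hV : ((convexHull ℝ S).extremePoints ℝ).Finite := hS.subset extremePoints_convexHull_subset
  rw [← (hV.isClosed_convexHull ℝ).closure_eq]
  exact closure_convexHull_extremePoints (hS.isCompact_convexHull ℝ) (convex_convexHull ℝ S)

theorem exists_mem_le_inner_of_mem_convexHull {E : Type*} [NormedAddCommGroup E]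
    [InnerProductSpace ℝ E] {V : Set E} {x y : E} (hy : y ∈ convexHull ℝ V) :
    ∃ v ∈ V, ⟪x, y⟫ ≤ ⟪x, v⟫ := by
  by_contra! h
  have hsub : convexHull ℝ V ⊆ {v | ⟪x, v⟫ < ⟪x, y⟫} :=
    convexHull_min h (convex_halfSpace_lt (innerSL ℝ x).isLinear _)
  exact lt_irrefl ⟪x, y⟫ (hsub hy)

/-- Comparing the Gaussian measure of a section of slabs with that of a polytope containing it. -/
theorem pow_le_exp_add_ncard_extremePoints_mul_exp {n m : ℕ} (hn : 0 < n) {β ε ρ : ℝ}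
    (hβ : 0 < β) (hε0 : 0 ≤ ε) (hε1 : ε < 1) (hρ : 0 < ρ)
    {u : Fin m → EuclideanSpace ℝ (Fin n)} {S : Set (EuclideanSpace ℝ (Fin n))} (hS : S.Finite)
    (hu : ∀ i, ‖u i‖ ≤ 1)
    (hK : {x : EuclideanSpace ℝ (Fin n) | ∀ i, |⟪x, u i⟫| ≤ 1} ⊆ convexHull ℝ S)
    (hP : convexHull ℝ S ⊆ Metric.closedBall 0 (β * Real.sqrt n)) :
    (1 - Real.exp (-(ρ ^ 2) / 2)) ^ m ≤ Real.exp (-(ε ^ 2 / 4) * n) +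
      ((convexHull ℝ S).extremePoints ℝ).ncard *
        Real.exp (-((1 - ε) ^ 2 / (2 * β ^ 2 * ρ ^ 2) * n)) := by
  have hV : ((convexHull ℝ S).extremePoints ℝ).Finite := hS.subset extremePoints_convexHull_subset
  have hn' : (0 : ℝ) < n := by exact_mod_cast hn
  set W := hV.toFinset with hW
  have hcover : {x : EuclideanSpace ℝ (Fin n) | ∀ i ∈ Finset.univ, |⟪x, u i⟫| ≤ ρ} ⊆
      {x | ‖x‖ ^ 2 ≤ (1 - ε) * n} ∪ ⋃ v ∈ W, {x | (1 - ε) * n / ρ ≤ ⟪x, v⟫} := by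
    intro x hx
    by_cases hxn : ‖x‖ ^ 2 ≤ (1 - ε) * n
    · exact Or.inl hxn
    right
    have hmem : ρ⁻¹ • x ∈ convexHull ℝ S := hK fun i ↦ by
      rw [real_inner_smul_left, abs_mul, abs_of_pos (inv_pos.2 hρ), inv_mul_le_iff₀ hρ, mul_one]
      exact hx i (Finset.mem_univ i)
    rw [← hS.convexHull_extremePoints] at hmem
    obtain ⟨v, hv, hxv⟩ := exists_mem_le_inner_of_mem_convexHull (x := x) hmem
    rw [real_inner_smul_right, real_inner_self_eq_norm_sq] at hxv
    refine mem_iUnion₂.2 ⟨v, hV.mem_toFinset.2 hv, le_trans ?_ hxv⟩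
    rw [div_eq_inv_mul]
    exact mul_le_mul_of_nonneg_left (not_le.1 hxn).le (inv_pos.2 hρ).le
  have hvert : ∀ v ∈ W, (stdGaussian (EuclideanSpace ℝ (Fin n))).real
      {x | (1 - ε) * n / ρ ≤ ⟪x, v⟫} ≤
        Real.exp (-((1 - ε) ^ 2 / (2 * β ^ 2 * ρ ^ 2) * n)) := by
    intro v hv
    have hvn : ‖v‖ ≤ β * Real.sqrt n :=
      mem_closedBall_zero_iff.1 (hP (extremePoints_subset (hV.mem_toFinset.1 hv)))
    have hvn2 : ‖v‖ ^ 2 ≤ β ^ 2 * n := by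
      rw [← Real.sq_sqrt hn'.le, ← mul_pow]
      exact pow_le_pow_left₀ (norm_nonneg v) hvn 2
    refine (stdGaussian_real_le_inner (by positivity) hvn2 ?_).trans_eq ?_
    · have := sub_pos.2 hε1
      positivity
    · congr 2
      field_simp
  calc (1 - Real.exp (-(ρ ^ 2) / 2)) ^ m
      ≤ (stdGaussian (EuclideanSpace ℝ (Fin n))).real
          {x | ∀ i ∈ Finset.univ, |⟪x, u i⟫| ≤ ρ} := by
        simpa using pow_card_le_stdGaussian_real_slabs u hu hρ.le Finset.univ
    _ ≤ _ := measureReal_mono hcover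
    _ ≤ _ := measureReal_union_le _ _
    _ ≤ Real.exp (-(ε ^ 2 / 4) * n) + ∑ _v ∈ W,
          Real.exp (-((1 - ε) ^ 2 / (2 * β ^ 2 * ρ ^ 2) * n)) :=
        add_le_add (stdGaussian_real_norm_sq_le hε0 hε1)
          ((measureReal_biUnion_finset_le _ _).trans (Finset.sum_le_sum hvert))
    _ = _ := by rw [Finset.sum_const, nsmul_eq_mul, ncard_eq_toFinset_card _ hV]

end

/-- The explicit estimate of `γ = γ(α, β)` in Theorem 1.1: if `0 < ε < 1` and `ρ > 0` satisfy
`α ln(1 - e^{-ρ²/2}) > -ε²/4` and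
`γ := (1-ε)²/(2β²ρ²) · (1 - e^{-ρ²/2}) + α ln(1 - e^{-ρ²/2}) > 0`,
then the conclusion of Theorem 1.1 holds with this `γ` for all sufficiently large `n`. -/
theorem stmt_1 (α β ε ρ γ : ℝ) (hα : 1 ≤ α) (hβ : 1 ≤ β)
    (hε0 : 0 < ε) (hε1 : ε < 1) (hρ : 0 < ρ)
    (h1 : -(ε ^ 2 / 4) < α * Real.log (1 - Real.exp (-(ρ ^ 2) / 2)))
    (hγdef : γ = (1 - ε) ^ 2 / (2 * β ^ 2 * ρ ^ 2) * (1 - Real.exp (-(ρ ^ 2) / 2))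
      + α * Real.log (1 - Real.exp (-(ρ ^ 2) / 2)))
    (hγ0 : 0 < γ) :
    ∃ N : ℕ, ∀ n : ℕ, N ≤ n →
      ∀ (m : ℕ) (u : Fin m → EuclideanSpace ℝ (Fin n))
        (S : Finset (EuclideanSpace ℝ (Fin n))),
        (∀ i, ‖u i‖ ≤ 1) → (m : ℝ) ≤ α * n →
        {x : EuclideanSpace ℝ (Fin n) | ∀ i, |⟪x, u i⟫| ≤ 1} ⊆
          convexHull ℝ (S : Set (EuclideanSpace ℝ (Fin n))) →
        convexHull ℝ (S : Set (EuclideanSpace ℝ (Fin n))) ⊆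
          Metric.closedBall 0 (β * Real.sqrt n) →
        Real.exp (γ * n) ≤
          ((Set.extremePoints ℝ
            (convexHull ℝ (S : Set (EuclideanSpace ℝ (Fin n))))).ncard : ℝ) := by
  have hexp : Real.exp (-(ρ ^ 2) / 2) < 1 := Real.exp_lt_one_iff.2 (by have := pow_pos hρ 2; linarith)
  have hlog : Real.log (1 - Real.exp (-(ρ ^ 2) / 2)) ≤ 0 :=
    Real.log_nonpos (by linarith) (by linarith [Real.exp_pos (-(ρ ^ 2) / 2)])
  have hqL : Real.exp (Real.log (1 - Real.exp (-(ρ ^ 2) / 2))) = 1 - Real.exp (-(ρ ^ 2) / 2) :=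
    Real.exp_log (by linarith)
  set L := Real.log (1 - Real.exp (-(ρ ^ 2) / 2)) with hL
  set c := (1 - ε) ^ 2 / (2 * β ^ 2 * ρ ^ 2) with hc
  have hβ0 : 0 < β := by linarith
  have hc0 : 0 < c := by
    have := sub_pos.2 hε1
    positivity
  set κ := c * Real.exp (-(ρ ^ 2) / 2) with hκ
  have hκ0 : 0 < κ := by positivity
  set δ := α * L + ε ^ 2 / 4 with hδ
  have hδ0 : 0 < δ := by linarith
  -- for large `n` both error factors are beaten: `2 ≤ exp (κ n)` and `2 ≤ exp (δ n)`
  obtain ⟨N, hN⟩ := exists_nat_ge (max (1 / κ) (1 / δ))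
  refine ⟨max N 1, fun n hn m u S hu hm hK hP ↦ ?_⟩
  have hn1 : 0 < n := (le_max_right N 1).trans hn
  have hNn : (N : ℝ) ≤ n := by exact_mod_cast (le_max_left N 1).trans hn
  have hκn : 1 ≤ κ * n := (div_le_iff₀' hκ0).1 ((le_max_left _ _).trans (hN.trans hNn))
  have hδn : 1 ≤ δ * n := (div_le_iff₀' hδ0).1 ((le_max_right _ _).trans (hN.trans hNn))
  have hκ2 : 2 ≤ Real.exp (κ * n) := by linarith [Real.add_one_le_exp (κ * n)]
  have hδ2 : 2 ≤ Real.exp (δ * n) := by linarith [Real.add_one_le_exp (δ * n)]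
  have key := pow_le_exp_add_ncard_extremePoints_mul_exp hn1 hβ0 hε0.le hε1 hρ S.finite_toSet
    hu hK hP
  set v : ℝ := ((Set.extremePoints ℝ
    (convexHull ℝ (S : Set (EuclideanSpace ℝ (Fin n))))).ncard : ℝ)
  have hlow : Real.exp (α * L * n) ≤ (1 - Real.exp (-(ρ ^ 2) / 2)) ^ m := by
    rw [← hqL, ← Real.exp_nat_mul]
    exact Real.exp_le_exp.2 (by nlinarith)
  have e1 : Real.exp (α * L * n) = Real.exp (δ * n) * Real.exp (-(ε ^ 2 / 4) * n) := by
    rw [← Real.exp_add, hδ]; ring_nf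
  have e2 : Real.exp (α * L * n) = Real.exp (γ * n) * Real.exp (κ * n) * Real.exp (-(c * n)) := by
    rw [← Real.exp_add, ← Real.exp_add, hγdef, hκ]; ring_nf
  have herr : 2 * Real.exp (-(ε ^ 2 / 4) * n) ≤ Real.exp (α * L * n) := by
    rw [e1]
    exact mul_le_mul_of_nonneg_right hδ2 (Real.exp_pos _).le
  have hmain : Real.exp (γ * n) * 2 * Real.exp (-(c * n)) ≤ Real.exp (α * L * n) := by
    rw [e2]
    gcongr
  refine le_of_mul_le_mul_right ?_ (Real.exp_pos (-(c * n)))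
  linarith
end

section
/- For every α ≥ 1 there exists a constant γ = γ(α) > 0 such that every n-dimensional centrally symmetric polytope P ⊂ ℝⁿ (i.e., a polytope with non-empty interior satisfying P = −P) with at most αn facets has at least 2^(γn) vertices. -/
open scoped RealInnerProductSpace

/-- `F` is a face of `P ⊆ ℝⁿ`: the (nonempty) intersection of `P` with a supporting
affine hyperplane. -/
def IsFaceOf {n : ℕ} (P F : Set (EuclideanSpace ℝ (Fin n))) : Prop :=
  F.Nonempty ∧ ∃ (c : EuclideanSpace ℝ (Fin n)) (b : ℝ), c ≠ 0 ∧
    (∀ x ∈ P, ⟪x, c⟫ ≤ b) ∧ F = P ∩ {x | ⟪x, c⟫ = b}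

/-- `F` is a facet of `P ⊆ ℝⁿ`: a face of codimension `1`, i.e. of dimension `n - 1`. -/
def IsFacetOf {n : ℕ} (P F : Set (EuclideanSpace ℝ (Fin n))) : Prop :=
  IsFaceOf P F ∧ Module.finrank ℝ (affineSpan ℝ F).direction = n - 1

open Filter Topology

/-- Second-order necessary condition at a minimum of a sum of exponentials. -/
theorem sum_mul_nonneg_of_eventually_le {κ : Type*} (V : Finset κ) (w p : κ → ℝ) (r : ℝ)
    (hw : ∀ v ∈ V, 0 ≤ w v)
    (h : ∀ᶠ ε in 𝓝 (0 : ℝ), ∑ v ∈ V, w v ≤ ∑ v ∈ V, w v * Real.exp (ε * p v - ε ^ 2 * r)) :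
    ∑ v ∈ V, w v * p v = 0 ∧ 0 ≤ ∑ v ∈ V, w v * (p v ^ 2 - 2 * r) := by
  constructor
  · have hd : HasDerivAt (fun ε : ℝ => ∑ v ∈ V, w v * Real.exp (ε * p v - ε ^ 2 * r))
        (∑ v ∈ V, w v * p v) 0 := by
      have := HasDerivAt.fun_sum (u := V) (x := (0 : ℝ))
        (A := fun v ε => w v * Real.exp (ε * p v - ε ^ 2 * r)) (A' := fun v => w v * p v) ?_
      · exact this
      intro v _
      have h1 : HasDerivAt (fun ε : ℝ => ε * p v - ε ^ 2 * r) (p v) 0 := by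
        have := ((hasDerivAt_id (0 : ℝ)).mul_const (p v)).fun_sub
          (((hasDerivAt_id (0 : ℝ)).fun_pow 2).mul_const r)
        simpa using this
      simpa using h1.exp.const_mul (w v)
    refine IsLocalMin.hasDerivAt_eq_zero ?_ hd
    filter_upwards [h] with ε hε
    simpa using hε
  · have hneg : ∀ᶠ ε in 𝓝 (0 : ℝ),
        ∑ v ∈ V, w v ≤ ∑ v ∈ V, w v * Real.exp (-ε * p v - (-ε) ^ 2 * r) := by
      have : Tendsto (fun ε : ℝ => -ε) (𝓝 0) (𝓝 0) := by
        simpa using (continuous_neg (G := ℝ)).tendsto 0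
      exact this.eventually h
    have hexp : ∀ᶠ ε in 𝓝 (0 : ℝ),
        ∑ v ∈ V, w v ≤ ∑ v ∈ V, w v * Real.exp (ε ^ 2 * (p v ^ 2 / 2 - r)) := by
      filter_upwards [h, hneg] with ε h1 h2
      have h3 : ∑ v ∈ V, w v * Real.exp (ε * p v - ε ^ 2 * r)
          + ∑ v ∈ V, w v * Real.exp (-ε * p v - (-ε) ^ 2 * r)
          ≤ 2 * ∑ v ∈ V, w v * Real.exp (ε ^ 2 * (p v ^ 2 / 2 - r)) := by
        rw [← Finset.sum_add_distrib, Finset.mul_sum]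
        refine Finset.sum_le_sum fun v hv => ?_
        have h4 := Real.cosh_le_exp_half_sq (ε * p v)
        rw [Real.cosh_eq] at h4
        have e1 : Real.exp (ε * p v - ε ^ 2 * r)
            = Real.exp (ε * p v) * Real.exp (-(ε ^ 2 * r)) := by
          rw [← Real.exp_add]; ring_nf
        have e2 : Real.exp (-ε * p v - (-ε) ^ 2 * r)
            = Real.exp (-(ε * p v)) * Real.exp (-(ε ^ 2 * r)) := by
          rw [← Real.exp_add]; ring_nf
        have e3 : Real.exp (ε ^ 2 * (p v ^ 2 / 2 - r))
            = Real.exp ((ε * p v) ^ 2 / 2) * Real.exp (-(ε ^ 2 * r)) := by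
          rw [← Real.exp_add]; ring_nf
        rw [e1, e2, e3]
        have h5 : 0 ≤ w v * Real.exp (-(ε ^ 2 * r)) := mul_nonneg (hw v hv) (Real.exp_pos _).le
        nlinarith [mul_le_mul_of_nonneg_left h4 h5]
      linarith
    have hd : HasDerivAt (fun δ : ℝ => ∑ v ∈ V, w v * Real.exp (δ * (p v ^ 2 / 2 - r)))
        (∑ v ∈ V, w v * (p v ^ 2 / 2 - r)) 0 := by
      have := HasDerivAt.fun_sum (u := V) (x := (0 : ℝ))
        (A := fun v δ => w v * Real.exp (δ * (p v ^ 2 / 2 - r)))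
        (A' := fun v => w v * (p v ^ 2 / 2 - r)) ?_
      · exact this
      intro v _
      simpa using ((hasDerivAt_id (0 : ℝ)).mul_const (p v ^ 2 / 2 - r)).exp.const_mul (w v)
    have hsqrt : Tendsto Real.sqrt (𝓝[>] 0) (𝓝 0) := by
      have := Real.continuous_sqrt.tendsto 0
      rw [Real.sqrt_zero] at this
      exact this.mono_left nhdsWithin_le_nhds
    have hnn : 0 ≤ ∑ v ∈ V, w v * (p v ^ 2 / 2 - r) := by
      have hslope := hd.tendsto_slope.mono_left
        (nhdsWithin_mono (0 : ℝ) fun x (hx : x ∈ Set.Ioi 0) => ne_of_gt hx)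
      refine ge_of_tendsto hslope ?_
      filter_upwards [hsqrt.eventually hexp, self_mem_nhdsWithin] with δ hδ hpos
      have hpos : 0 < δ := hpos
      rw [Real.sq_sqrt hpos.le] at hδ
      rw [slope_def_field]
      refine div_nonneg ?_ (by linarith)
      simpa using hδ
    have : ∑ v ∈ V, w v * (p v ^ 2 - 2 * r) = 2 * ∑ v ∈ V, w v * (p v ^ 2 / 2 - r) := by
      rw [Finset.mul_sum]
      exact Finset.sum_congr rfl fun v _ => by ring
    linarith

/-- Every `d`-dimensional central section of the cube `[-1, 1]^ι` that is contained in the convex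
hull of a finite set `V` of its points satisfies `exp (d ^ 2 / (8 |ι|)) ≤ |V|`. -/
theorem exp_le_card_of_cube_section {ι : Type*} [Fintype ι]
    (L : Submodule ℝ (EuclideanSpace ℝ ι)) (V : Finset (EuclideanSpace ℝ ι))
    (hV : ∀ v ∈ V, ∀ i, |v i| ≤ 1)
    (hLV : ∀ x ∈ L, (∀ i, |x i| ≤ 1) → x ∈ convexHull ℝ (V : Set (EuclideanSpace ℝ ι))) :
    Real.exp ((Module.finrank ℝ L : ℝ) ^ 2 / (8 * Fintype.card ι)) ≤ V.card := by
  classical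
  have hVne : V.Nonempty := by
    have := hLV 0 L.zero_mem (by simp)
    have := convexHull_nonempty_iff.1 ⟨_, this⟩
    exact_mod_cast this
  set d := Module.finrank ℝ L with hd
  set M := Fintype.card ι with hM
  rcases Nat.eq_zero_or_pos d with h0 | hdpos
  · rw [h0]
    simpa using hVne
  have hdM : d ≤ M := by
    have := Submodule.finrank_le L
    rwa [finrank_euclideanSpace] at this
  have hd' : (0 : ℝ) < d := by exact_mod_cast hdpos
  have hM' : (0 : ℝ) < M := by exact_mod_cast hdpos.trans_le hdM
  set l : ℝ := d / (2 * M) with hl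
  set ν : ℝ := d / (4 * M) with hν
  have hlpos : 0 < l := by positivity
  have hνpos : 0 < ν := by positivity
  have hnorm : ∀ v ∈ V, ‖v‖ ^ 2 ≤ M := by
    intro v hv
    rw [EuclideanSpace.real_norm_sq_eq]
    calc ∑ i, v i ^ 2 ≤ ∑ _i : ι, (1 : ℝ) :=
          Finset.sum_le_sum fun i _ => (sq_le_one_iff_abs_le_one _).2 (hV v hv i)
      _ = M := by simp [hM]
  set K : Set (EuclideanSpace ℝ ι) := {x | x ∈ L ∧ ∀ i, |x i| ≤ 1} with hK
  have hKc : IsCompact K := by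
    refine (V.finite_toSet.isCompact_convexHull (𝕜 := ℝ)).of_isClosed_subset ?_
      fun x hx => hLV x hx.1 hx.2
    have hcube : IsClosed (⋂ i, {x : EuclideanSpace ℝ ι | |x i| ≤ 1}) :=
      isClosed_iInter fun i => isClosed_le
        (f := fun x : EuclideanSpace ℝ ι => |x i|) (g := fun _ => 1) (by fun_prop) (by fun_prop)
    convert (Submodule.closed_of_finiteDimensional L).inter hcube using 1
    ext x
    simp [hK]
  obtain ⟨x, ⟨hxL, hxc⟩, hmin⟩ := hKc.exists_isMinOn (f := fun x =>
    ∑ v ∈ V, Real.exp (l * ⟪x, v⟫ - ν * ‖x‖ ^ 2)) ⟨0, L.zero_mem, by simp⟩ (by fun_prop)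
  set w : EuclideanSpace ℝ ι → ℝ := fun v => Real.exp (l * ⟪x, v⟫ - ν * ‖x‖ ^ 2) with hw
  have hWpos : 0 < ∑ v ∈ V, w v := Finset.sum_pos (fun v _ => Real.exp_pos _) hVne
  let T : Finset ι := Finset.univ.filter fun i => |x i| = 1
  have hT : (T.card : ℝ) ≤ ‖x‖ ^ 2 := by
    rw [EuclideanSpace.real_norm_sq_eq]
    calc (T.card : ℝ) = ∑ i ∈ T, (1 : ℝ) := by simp
      _ = ∑ i ∈ T, x i ^ 2 := Finset.sum_congr rfl fun i hi => by
          rw [← sq_abs, (Finset.mem_filter.1 hi).2, one_pow]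
      _ ≤ ∑ i, x i ^ 2 := Finset.sum_le_sum_of_subset_of_nonneg (Finset.subset_univ _)
          fun i _ _ => sq_nonneg _
  let f : L →ₗ[ℝ] (T → ℝ) :=
    { toFun := fun y i => (y : EuclideanSpace ℝ ι) i
      map_add' := fun _ _ => rfl
      map_smul' := fun _ _ => rfl }
  have hker : d ≤ T.card + Module.finrank ℝ (LinearMap.ker f) := by
    have h1 := LinearMap.finrank_range_add_finrank_ker f
    have h2 := Submodule.finrank_le (LinearMap.range f)
    rw [Module.finrank_fintype_fun_eq_card, Fintype.card_coe] at h2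
    omega
  have hsecond : ∀ y : LinearMap.ker f,
      2 * ν * ‖y‖ ^ 2 * ∑ v ∈ V, w v
        ≤ ∑ v ∈ V, w v * (l ^ 2 * ⟪((y : L) : EuclideanSpace ℝ ι), v⟫ ^ 2) := by
    intro y
    set z : EuclideanSpace ℝ ι := ((y : L) : EuclideanSpace ℝ ι) with hz
    have hyz : ‖y‖ = ‖z‖ := rfl
    set q : ℝ := 2 * ν * ⟪x, z⟫ with hq
    have hzT : ∀ i, |x i| = 1 → z i = 0 := fun i hi =>
      congrFun (LinearMap.mem_ker.1 y.2) ⟨i, Finset.mem_filter.2 ⟨Finset.mem_univ _, hi⟩⟩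
    have hev : ∀ᶠ ε in 𝓝 (0 : ℝ), x + ε • z ∈ K := by
      have : ∀ᶠ ε in 𝓝 (0 : ℝ), ∀ i, |(x + ε • z) i| ≤ 1 := by
        refine eventually_all.2 fun i => ?_
        by_cases hi : |x i| = 1
        · simp [hzT i hi, hi]
        · have hlt : |(x + (0 : ℝ) • z) i| < 1 := by
            simpa using lt_of_le_of_ne (hxc i) hi
          have hc : Continuous fun ε : ℝ => |(x + ε • z) i| := by
            simp only [PiLp.add_apply, PiLp.smul_apply]
            fun_prop
          exact (hc.tendsto 0).eventually (ge_mem_nhds hlt)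
      filter_upwards [this] with ε hε
      exact ⟨L.add_mem hxL (L.smul_mem _ (y : L).2), hε⟩
    obtain ⟨h1, h2⟩ := sum_mul_nonneg_of_eventually_le V w (fun v => l * ⟪z, v⟫ - q)
      (ν * ‖z‖ ^ 2) (fun v _ => (Real.exp_pos _).le) (by
        filter_upwards [hev] with ε hε
        refine (hmin hε).trans_eq (Finset.sum_congr rfl fun v _ => ?_)
        rw [hw, ← Real.exp_add, norm_add_sq_real, inner_add_left, inner_smul_left,
          inner_smul_right, norm_smul, mul_pow, Real.norm_eq_abs, sq_abs, hq]
        simp only [conj_trivial]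
        ring_nf)
    have hexpand : ∑ v ∈ V, w v * (l ^ 2 * ⟪z, v⟫ ^ 2)
        = ∑ v ∈ V, w v * ((l * ⟪z, v⟫ - q) ^ 2 - 2 * (ν * ‖z‖ ^ 2))
          + 2 * q * ∑ v ∈ V, w v * (l * ⟪z, v⟫ - q)
          + (q ^ 2 + 2 * (ν * ‖z‖ ^ 2)) * ∑ v ∈ V, w v := by
      rw [Finset.mul_sum, Finset.mul_sum, ← Finset.sum_add_distrib, ← Finset.sum_add_distrib]
      exact Finset.sum_congr rfl fun v _ => by ring
    rw [hexpand, h1, hyz]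
    nlinarith [mul_nonneg (sq_nonneg q) hWpos.le]
  set k := Module.finrank ℝ (LinearMap.ker f) with hk
  let b := stdOrthonormalBasis ℝ (LinearMap.ker f)
  have hbessel : ∀ v ∈ V, ∑ j, ⟪((b j : L) : EuclideanSpace ℝ ι), v⟫ ^ 2 ≤ M := by
    intro v hv
    have hon : Orthonormal ℝ fun j => ((b j : L) : EuclideanSpace ℝ ι) :=
      (b.orthonormal.comp_linearIsometry (LinearMap.ker f).subtypeₗᵢ).comp_linearIsometry
        L.subtypeₗᵢ
    have := hon.sum_inner_products_le v (s := Finset.univ)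
    simp only [Real.norm_eq_abs, sq_abs] at this
    exact this.trans (hnorm v hv)
  have hsum : 2 * ν * k * ∑ v ∈ V, w v ≤ l ^ 2 * M * ∑ v ∈ V, w v := by
    calc 2 * ν * k * ∑ v ∈ V, w v
        = ∑ j, 2 * ν * ‖b j‖ ^ 2 * ∑ v ∈ V, w v := by
          simp [hk]; ring
      _ ≤ ∑ j, ∑ v ∈ V, w v * (l ^ 2 * ⟪((b j : L) : EuclideanSpace ℝ ι), v⟫ ^ 2) :=
          Finset.sum_le_sum fun j _ => hsecond (b j)
      _ = ∑ v ∈ V, w v * (l ^ 2 * ∑ j, ⟪((b j : L) : EuclideanSpace ℝ ι), v⟫ ^ 2) := by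
          rw [Finset.sum_comm]
          simp only [Finset.mul_sum]
      _ ≤ ∑ v ∈ V, w v * (l ^ 2 * M) := by
          refine Finset.sum_le_sum fun v hv => ?_
          have := hbessel v hv
          have := Real.exp_pos (l * ⟪x, v⟫ - ν * ‖x‖ ^ 2)
          gcongr
      _ = _ := by rw [← Finset.sum_mul]; ring
  have hkd : (k : ℝ) ≤ d / 2 := by
    have h1 := le_of_mul_le_mul_right hsum hWpos
    have h2 : l ^ 2 * M = 2 * ν * (d / 2) := by rw [hl, hν]; field_simp; norm_num
    rw [h2] at h1
    exact le_of_mul_le_mul_left h1 (by positivity)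
  have hs : (d : ℝ) / 2 ≤ ‖x‖ ^ 2 := by
    have : (d : ℝ) ≤ T.card + k := by exact_mod_cast hker
    linarith
  obtain ⟨v, hv, hxv⟩ : ∃ v ∈ V, ‖x‖ ^ 2 ≤ ⟪x, v⟫ := by
    have hlin : ConvexOn ℝ (convexHull ℝ (V : Set (EuclideanSpace ℝ ι))) (innerₛₗ ℝ x) :=
      (innerₛₗ ℝ x).convexOn (convex_convexHull ℝ _)
    obtain ⟨v, hv, h⟩ := hlin.exists_ge_of_mem_convexHull (subset_convexHull ℝ _) (hLV x hxL hxc)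
    refine ⟨v, hv, ?_⟩
    simpa using h
  calc Real.exp ((d : ℝ) ^ 2 / (8 * M)) ≤ w v := by
        refine Real.exp_le_exp.2 ?_
        have e1 : (d : ℝ) ^ 2 / (8 * M) = ν * (d / 2) := by rw [hν]; field_simp; norm_num
        have e2 : l = 2 * ν := by rw [hl, hν]; field_simp; norm_num
        rw [e1, e2]
        nlinarith [mul_le_mul_of_nonneg_left hxv hνpos.le, mul_le_mul_of_nonneg_left hs hνpos.le]
    _ ≤ ∑ v ∈ V, w v := Finset.single_le_sum (f := w) (fun v _ => (Real.exp_pos _).le) hv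
    _ ≤ V.card := by
        simpa using hmin (show (0 : EuclideanSpace ℝ ι) ∈ K from ⟨L.zero_mem, by simp⟩)

theorem inner_le_of_mem_convexHull {E : Type*} [NormedAddCommGroup E]
    [InnerProductSpace ℝ E] {S : Set E} {c x : E} {b : ℝ}
    (h : ∀ s ∈ S, ⟪s, c⟫ ≤ b) (hx : x ∈ convexHull ℝ S) : ⟪x, c⟫ ≤ b := by
  have hconv : Convex ℝ {x : E | ⟪x, c⟫ ≤ b} := by
    simpa [real_inner_comm] using convex_halfSpace_le (innerₛₗ ℝ c).isLinear b
  exact convexHull_min h hconv hx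

section Polar

variable {E : Type*} [NormedAddCommGroup E] [InnerProductSpace ℝ E] [FiniteDimensional ℝ E]

/-- The constraints that are active at an extreme point of a polyhedron span the whole space. -/
theorem span_active_eq_top_of_mem_extremePoints (S : Finset E) {c : E}
    (hc : c ∈ Set.extremePoints ℝ {c : E | ∀ s ∈ S, ⟪s, c⟫ ≤ 1}) :
    Submodule.span ℝ {s : E | s ∈ S ∧ ⟪s, c⟫ = 1} = ⊤ := by
  rw [← Submodule.orthogonal_eq_bot_iff, Submodule.eq_bot_iff]
  intro y hy
  have hyz : ∀ s ∈ S, ⟪s, c⟫ = 1 → ⟪s, y⟫ = 0 := fun s hs h =>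
    (Submodule.mem_orthogonal _ _).1 hy s (Submodule.subset_span ⟨hs, h⟩)
  have hev : ∀ᶠ ε in 𝓝 (0 : ℝ), ∀ s ∈ S, ⟪s, c + ε • y⟫ ≤ 1 := by
    refine (Finset.eventually_all S).2 fun s hs => ?_
    by_cases h : ⟪s, c⟫ = 1
    · simp [inner_add_right, inner_smul_right, hyz s hs h, h]
    · have hlt : ⟪s, c + (0 : ℝ) • y⟫ < 1 := by simpa using lt_of_le_of_ne (hc.1 s hs) h
      have hcont : Continuous fun ε : ℝ => ⟪s, c + ε • y⟫ := by fun_prop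
      exact (hcont.tendsto 0).eventually (ge_mem_nhds hlt)
  have hneg : ∀ᶠ ε in 𝓝 (0 : ℝ), ∀ s ∈ S, ⟪s, c + (-ε) • y⟫ ≤ 1 := by
    have : Tendsto (fun ε : ℝ => -ε) (𝓝 0) (𝓝 0) := by
      simpa using (continuous_neg (G := ℝ)).tendsto 0
    exact this.eventually hev
  obtain ⟨ε, ⟨h1, h2⟩, hε⟩ := (((hev.and hneg).filter_mono nhdsWithin_le_nhds).and
    (self_mem_nhdsWithin (s := Set.Ioi (0 : ℝ)))).exists
  have hε : 0 < ε := hε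
  have hmem : c ∈ openSegment ℝ (c + ε • y) (c + (-ε) • y) :=
    ⟨1 / 2, 1 / 2, by norm_num, by norm_num, by norm_num, by module⟩
  have := hc.2 h1 h2 hmem
  simpa [hε.ne'] using this

/-- The polar of a polytope with `0` in its interior is compact. -/
theorem isCompact_polar (S : Finset E) (h0 : (0 : E) ∈ interior (convexHull ℝ (S : Set E))) :
    IsCompact {c : E | ∀ s ∈ S, ⟪s, c⟫ ≤ 1} := by
  refine Metric.isCompact_of_isClosed_isBounded ?_ ?_
  · have : IsClosed (⋂ s ∈ S, {c : E | ⟪s, c⟫ ≤ 1}) :=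
      isClosed_biInter fun s _ => isClosed_le (by fun_prop) (by fun_prop)
    convert this using 1
    ext c
    simp
  · obtain ⟨r, hr, hball⟩ := Metric.mem_nhds_iff.1 (mem_interior_iff_mem_nhds.1 h0)
    refine (Metric.isBounded_closedBall (x := (0 : E)) (r := 2 / r)).subset fun c hc => ?_
    rw [mem_closedBall_zero_iff]
    rcases eq_or_ne c 0 with rfl | hc0
    · rw [norm_zero]; positivity
    have hcpos : 0 < ‖c‖ := norm_pos_iff.2 hc0
    have hmem : (r / (2 * ‖c‖)) • c ∈ convexHull ℝ (S : Set E) := by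
      refine hball ?_
      rw [mem_ball_zero_iff, norm_smul, Real.norm_of_nonneg (by positivity)]
      field_simp
      linarith
    have := inner_le_of_mem_convexHull (fun s hs => hc s hs) hmem
    rw [inner_smul_left, real_inner_self_eq_norm_sq] at this
    simp only [conj_trivial] at this
    rw [le_div_iff₀ hr]
    field_simp at this
    linarith

/-- A polytope with `0` in its interior is cut out by the extreme points of its polar. -/
theorem mem_convexHull_of_forall_extremePoints_polar (S : Finset E)
    (h0 : (0 : E) ∈ interior (convexHull ℝ (S : Set E))) {x : E}
    (hx : ∀ c ∈ Set.extremePoints ℝ {c : E | ∀ s ∈ S, ⟪s, c⟫ ≤ 1}, ⟪x, c⟫ ≤ 1) :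
    x ∈ convexHull ℝ (S : Set E) := by
  have hhalf : Convex ℝ {c : E | ⟪x, c⟫ ≤ 1} := convex_halfSpace_le (innerₛₗ ℝ x).isLinear 1
  have hconv : Convex ℝ {c : E | ∀ s ∈ S, ⟪s, c⟫ ≤ 1} := by
    have : Convex ℝ (⋂ s ∈ S, {c : E | ⟪s, c⟫ ≤ 1}) :=
      convex_iInter₂ fun s _ => convex_halfSpace_le (innerₛₗ ℝ s).isLinear 1
    convert this using 1
    ext c
    simp
  have hpolar : ∀ c ∈ {c : E | ∀ s ∈ S, ⟪s, c⟫ ≤ 1}, ⟪x, c⟫ ≤ 1 := by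
    rw [← closure_convexHull_extremePoints (isCompact_polar S h0) hconv]
    have hcl : IsClosed {c : E | ⟪x, c⟫ ≤ 1} := isClosed_le (by fun_prop) (by fun_prop)
    exact closure_minimal (convexHull_min hx hhalf) hcl
  by_contra hxP
  obtain ⟨f, u, hfu, hux⟩ := geometric_hahn_banach_closed_point (convex_convexHull ℝ (S : Set E))
    (S.finite_toSet.isCompact_convexHull (𝕜 := ℝ)).isClosed hxP
  have hu : 0 < u := by simpa using hfu 0 (interior_subset h0)
  have hdual : ∀ y, ⟪y, u⁻¹ • (InnerProductSpace.toDual ℝ E).symm f⟫ = u⁻¹ * f y := fun y => by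
    rw [inner_smul_right, real_inner_comm, InnerProductSpace.toDual_symm_apply]
  have := hpolar (u⁻¹ • (InnerProductSpace.toDual ℝ E).symm f) fun s hs => by
    rw [hdual, inv_mul_le_iff₀ hu, mul_one]
    exact (hfu s (subset_convexHull ℝ _ hs)).le
  rw [hdual, inv_mul_le_iff₀ hu, mul_one] at this
  exact absurd this (not_le.2 hux)

end Polar

section Facets

variable {n : ℕ}

/-- A polytope has finitely many facets. -/
theorem finite_setOf_isFacetOf (S : Finset (EuclideanSpace ℝ (Fin n))) :
    {F | IsFacetOf (convexHull ℝ (S : Set (EuclideanSpace ℝ (Fin n)))) F}.Finite := by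
  set P := convexHull ℝ (S : Set (EuclideanSpace ℝ (Fin n))) with hP
  have hPc : IsCompact P := S.finite_toSet.isCompact_convexHull (𝕜 := ℝ)
  have hexp : ∀ F, IsFacetOf P F → IsExposed ℝ P F := by
    rintro F ⟨⟨⟨z, hz⟩, c, b, -, hb, rfl⟩, -⟩ -
    refine ⟨innerSL ℝ c, ?_⟩
    have hcomm : ∀ y, innerSL ℝ c y = ⟪y, c⟫ := fun y => real_inner_comm y c
    ext x
    simp only [Set.mem_inter_iff, Set.mem_ofPred_eq, hcomm]
    refine and_congr_right fun hx => ⟨fun h y hy => (hb y hy).trans_eq h.symm, fun h => ?_⟩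
    exact le_antisymm (hb x hx) (hz.2.symm.trans_le (h z hz.1))
  refine Set.Finite.of_injOn (f := Set.extremePoints ℝ)
    (t := {T | T ⊆ (S : Set (EuclideanSpace ℝ (Fin n)))})
    ?_ ?_
    S.finite_toSet.finite_subsets
  · intro F hF
    exact ((hexp F hF).isExtreme.extremePoints_subset_extremePoints).trans
      extremePoints_convexHull_subset
  · intro F hF G hG hFG
    rw [← closure_convexHull_extremePoints ((hexp F hF).isCompact hPc)
        ((hexp F hF).convex (convex_convexHull ℝ _)),
      ← closure_convexHull_extremePoints ((hexp G hG).isCompact hPc)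
        ((hexp G hG).convex (convex_convexHull ℝ _)), hFG]

/-- Every extreme point of the polar of a polytope defines a facet of the polytope. -/
theorem isFacetOf_of_mem_extremePoints_polar (hn : 0 < n)
    (S : Finset (EuclideanSpace ℝ (Fin n))) {c : EuclideanSpace ℝ (Fin n)}
    (hc : c ∈ Set.extremePoints ℝ {c : EuclideanSpace ℝ (Fin n) | ∀ s ∈ S, ⟪s, c⟫ ≤ 1}) :
    IsFacetOf (convexHull ℝ (S : Set (EuclideanSpace ℝ (Fin n))))
      (convexHull ℝ (S : Set (EuclideanSpace ℝ (Fin n))) ∩ {x | ⟪x, c⟫ = 1}) := by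
  have : Nonempty (Fin n) := ⟨⟨0, hn⟩⟩
  have hspan := span_active_eq_top_of_mem_extremePoints S hc
  set F := convexHull ℝ (S : Set (EuclideanSpace ℝ (Fin n))) ∩ {x | ⟪x, c⟫ = 1} with hF
  have hsub : {s | s ∈ S ∧ ⟪s, c⟫ = 1} ⊆ F := fun s hs => ⟨subset_convexHull ℝ _ hs.1, hs.2⟩
  obtain ⟨p, hp⟩ : {s : EuclideanSpace ℝ (Fin n) | s ∈ S ∧ ⟪s, c⟫ = 1}.Nonempty := by
    rw [Set.nonempty_iff_ne_empty]
    intro h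
    rw [h, Submodule.span_empty] at hspan
    exact bot_ne_top hspan
  have hc0 : c ≠ 0 := by
    rintro rfl
    simpa using hp.2
  refine ⟨⟨⟨p, hsub hp⟩, c, 1, hc0, fun x hx => inner_le_of_mem_convexHull hc.1 hx, rfl⟩, ?_⟩
  set D := (affineSpan ℝ F).direction with hD
  have hdle : D ≤ (ℝ ∙ c)ᗮ := by
    rw [hD, direction_affineSpan, vectorSpan_def, Submodule.span_le]
    rintro _ ⟨x, hx, y, hy, rfl⟩
    have hx2 : ⟪x, c⟫ = 1 := hx.2
    have hy2 : ⟪y, c⟫ = 1 := hy.2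
    rw [SetLike.mem_coe, Submodule.mem_orthogonal_singleton_iff_inner_left]
    simp [inner_sub_left, hx2, hy2]
  have hsup : D ⊔ (ℝ ∙ p) = ⊤ := by
    rw [eq_top_iff, ← hspan, Submodule.span_le]
    intro s hs
    have h1 : s - p ∈ D := AffineSubspace.vsub_mem_direction
      (subset_affineSpan ℝ _ (hsub hs)) (subset_affineSpan ℝ _ (hsub hp))
    have := Submodule.add_mem_sup h1 (Submodule.mem_span_singleton_self p)
    simpa using this
  have h1 := Submodule.finrank_mono hdle
  have h2 := Submodule.finrank_add_finrank_orthogonal (ℝ ∙ c)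
  rw [finrank_span_singleton hc0, finrank_euclideanSpace_fin] at h2
  have h3 := Submodule.finrank_add_le_finrank_add_finrank D (ℝ ∙ p)
  rw [hsup, finrank_top, finrank_euclideanSpace_fin] at h3
  have h4 : Module.finrank ℝ (ℝ ∙ p) ≤ 1 := finrank_span_le_card {p} |>.trans (by simp)
  omega

theorem injOn_facet_of_extremePoints_polar (S : Finset (EuclideanSpace ℝ (Fin n))) :
    Set.InjOn (fun c => convexHull ℝ (S : Set (EuclideanSpace ℝ (Fin n))) ∩ {x | ⟪x, c⟫ = 1})
      (Set.extremePoints ℝ {c : EuclideanSpace ℝ (Fin n) | ∀ s ∈ S, ⟪s, c⟫ ≤ 1}) := by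
  intro c hc c' _ heq
  have hspan := span_active_eq_top_of_mem_extremePoints S hc
  have hle : Submodule.span ℝ {s | s ∈ S ∧ ⟪s, c⟫ = 1} ≤ (ℝ ∙ (c - c'))ᗮ := by
    rw [Submodule.span_le]
    intro s hs
    have hs' : ⟪s, c'⟫ = 1 := (heq.subset ⟨subset_convexHull ℝ _ hs.1, hs.2⟩).2
    rw [SetLike.mem_coe, Submodule.mem_orthogonal_singleton_iff_inner_left, inner_sub_right, hs.2,
      hs', sub_self]
  have : c - c' ∈ (ℝ ∙ (c - c'))ᗮ := hle (hspan ▸ Submodule.mem_top)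
  rw [Submodule.mem_orthogonal_singleton_iff_inner_left, inner_self_eq_zero] at this
  exact sub_eq_zero.1 this

end Facets

/-- **Corollary 1.2.** For every `α ≥ 1` there is `γ > 0` such that every `n`-dimensional
centrally symmetric polytope with at most `αn` facets has at least `2^{γn}` vertices
(extreme points). -/
theorem stmt_2 (α : ℝ) (hα : 1 ≤ α) :
    ∃ γ > (0 : ℝ), ∀ (n : ℕ) (S : Finset (EuclideanSpace ℝ (Fin n))),
      (interior (convexHull ℝ (S : Set (EuclideanSpace ℝ (Fin n))))).Nonempty →
      convexHull ℝ (S : Set (EuclideanSpace ℝ (Fin n))) =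
        -convexHull ℝ (S : Set (EuclideanSpace ℝ (Fin n))) →
      (({F | IsFacetOf (convexHull ℝ (S : Set (EuclideanSpace ℝ (Fin n)))) F}.ncard : ℝ)
        ≤ α * n) →
      (2 : ℝ) ^ (γ * n) ≤
        ((Set.extremePoints ℝ
          (convexHull ℝ (S : Set (EuclideanSpace ℝ (Fin n))))).ncard : ℝ) := by
  refine ⟨1 / (8 * α), by positivity, fun n S hint hsymm hfac => ?_⟩
  set P := convexHull ℝ (S : Set (EuclideanSpace ℝ (Fin n))) with hP
  set C := Set.extremePoints ℝ {c : EuclideanSpace ℝ (Fin n) | ∀ s ∈ S, ⟪s, c⟫ ≤ 1} with hC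
  have hPc : IsCompact P := S.finite_toSet.isCompact_convexHull (𝕜 := ℝ)
  have hPconv : Convex ℝ P := convex_convexHull ℝ _
  have hVfin : (Set.extremePoints ℝ P).Finite :=
    S.finite_toSet.subset extremePoints_convexHull_subset
  have hVhull : convexHull ℝ (Set.extremePoints ℝ P) = P := by
    rw [← (hVfin.isCompact_convexHull (𝕜 := ℝ)).isClosed.closure_eq]
    exact closure_convexHull_extremePoints hPc hPconv
  have h0 : (0 : EuclideanSpace ℝ (Fin n)) ∈ interior P := by
    obtain ⟨x, hx⟩ := hint
    have hnx : -x ∈ interior P := by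
      obtain ⟨U, hUP, hU, hxU⟩ := mem_interior.1 hx
      refine mem_interior.2 ⟨-U, ?_, hU.neg, by simpa using hxU⟩
      rw [hsymm]
      exact Set.neg_subset_neg.2 hUP
    have := hPconv.interior hx hnx (by norm_num : (0 : ℝ) ≤ 1 / 2) (by norm_num : (0 : ℝ) ≤ 1 / 2)
      (by norm_num)
    simpa using this
  rcases Nat.eq_zero_or_pos n with rfl | hn
  · have hpos : 0 < (Set.extremePoints ℝ P).ncard :=
      (Set.ncard_pos hVfin).2 (hPc.extremePoints_nonempty ⟨0, interior_subset h0⟩)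
    simpa using Nat.one_le_iff_ne_zero.2 hpos.ne'
  have hinj := injOn_facet_of_extremePoints_polar S
  have hmaps : Set.MapsTo (fun c => P ∩ {x | ⟪x, c⟫ = 1}) C {F | IsFacetOf P F} :=
    fun c hc => isFacetOf_of_mem_extremePoints_polar hn S hc
  have hCfin : C.Finite := Set.Finite.of_injOn hmaps hinj (finite_setOf_isFacetOf S)
  have hCcard : (C.ncard : ℝ) ≤ α * n := by
    refine le_trans ?_ hfac
    exact_mod_cast Set.ncard_le_ncard_of_injOn _ hmaps hinj (finite_setOf_isFacetOf S)
  have := hCfin.fintype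
  let A : EuclideanSpace ℝ (Fin n) →ₗ[ℝ] EuclideanSpace ℝ C :=
    (WithLp.linearEquiv 2 ℝ (C → ℝ)).symm.toLinearMap ∘ₗ
      LinearMap.pi fun c => innerₛₗ ℝ (c : EuclideanSpace ℝ (Fin n))
  have hA : ∀ x c, A x c = ⟪x, (c : EuclideanSpace ℝ (Fin n))⟫ := fun x c =>
    real_inner_comm x (c : EuclideanSpace ℝ (Fin n))
  have hmem : ∀ x, (∀ c, |A x c| ≤ 1) → x ∈ P := fun x hx =>
    mem_convexHull_of_forall_extremePoints_polar S h0 fun c hc => by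
      simpa [hA] using (abs_le.1 (hx ⟨c, hc⟩)).2
  have hAinj : Function.Injective A := by
    rw [← LinearMap.ker_eq_bot, LinearMap.ker_eq_bot']
    intro x hx
    obtain ⟨R, hR⟩ := hPc.isBounded.exists_norm_le
    by_contra hx0
    have hxpos : 0 < ‖x‖ := norm_pos_iff.2 hx0
    have h1 := hR (((|R| + 1) / ‖x‖) • x) (hmem _ fun c => by simp [hx])
    rw [norm_smul, Real.norm_of_nonneg (by positivity), div_mul_cancel₀ _ hxpos.ne'] at h1
    linarith [le_abs_self R]
  have hrank : Module.finrank ℝ (LinearMap.range A) = n := by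
    rw [LinearMap.finrank_range_of_inj hAinj, finrank_euclideanSpace_fin]
  have hcard : Fintype.card C = C.ncard := by
    rw [← Nat.card_eq_fintype_card, Nat.card_coe_set_eq]
  classical
  have hmain := exp_le_card_of_cube_section (LinearMap.range A) (hVfin.toFinset.image A) (by
      intro v hv c
      obtain ⟨x, hx, rfl⟩ := Finset.mem_image.1 hv
      have hxP : x ∈ P := ((Set.Finite.mem_toFinset _).1 hx).1
      have hnxP : -x ∈ P := by
        rw [hsymm]
        simpa using hxP
      have h1 := inner_le_of_mem_convexHull c.2.1 hxP
      have h2 := inner_le_of_mem_convexHull c.2.1 hnxP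
      rw [inner_neg_left] at h2
      rw [hA, abs_le]
      exact ⟨by linarith, h1⟩) (by
      rintro _ ⟨x, rfl⟩ hx
      rw [Finset.coe_image, Set.Finite.coe_toFinset, ← LinearMap.image_convexHull, hVhull]
      exact ⟨x, hmem x hx, rfl⟩)
  have hnC : n ≤ C.ncard := by
    have := Submodule.finrank_le (LinearMap.range A)
    rwa [hrank, finrank_euclideanSpace, hcard] at this
  rw [hrank, hcard] at hmain
  have hn' : (0 : ℝ) < n := by exact_mod_cast hn
  have hCpos : (0 : ℝ) < C.ncard := by exact_mod_cast hn.trans_le hnC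
  have hexp : 1 / (8 * α) * (n : ℝ) ≤ (n : ℝ) ^ 2 / (8 * C.ncard) := by
    rw [le_div_iff₀ (by positivity)]
    calc 1 / (8 * α) * (n : ℝ) * (8 * C.ncard) ≤ 1 / (8 * α) * (n : ℝ) * (8 * (α * n)) := by
          gcongr
      _ = (n : ℝ) ^ 2 := by field_simp
  have hpow : (2 : ℝ) ^ (1 / (8 * α) * (n : ℝ)) ≤ Real.exp (1 / (8 * α) * (n : ℝ)) := by
    rw [Real.rpow_def_of_pos two_pos]
    refine Real.exp_le_exp.2 (mul_le_of_le_one_left (by positivity) ?_)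
    linarith [Real.log_two_lt_d9]
  calc (2 : ℝ) ^ (1 / (8 * α) * (n : ℝ)) ≤ Real.exp ((n : ℝ) ^ 2 / (8 * C.ncard)) :=
        hpow.trans (Real.exp_le_exp.2 hexp)
    _ ≤ ((hVfin.toFinset.image A).card : ℝ) := hmain
    _ ≤ ((Set.extremePoints ℝ P).ncard : ℝ) := by
        rw [Set.ncard_eq_toFinset_card _ hVfin]
        exact_mod_cast Finset.card_image_le
end
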